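/- arXiv:2004.07367 — 7 statements merged into one kernel-verified Lean document; each statement's English description precedes it below -/
import Mathlib

section
/- Let (Z,d) be a compact metric space and (𝒱_n)_{n≥0} an essential refining sequence of finite closed covers of Z. Then the set ℐ = {p ∈ 𝒫 : p is the unique path q with π(q) = π(p)} is a dense G_δ subset of the path space 𝒫. -/
open Set Metric Topology

/-- The space of infinite paths of the approximation graph associated with a
sequence of covers `V`: choices `p n ∈ V n` with `p (n+1) ⊆ p n`. -/
def ApproxPath {Z : Type*} (V : ℕ → Set (Set Z)) : Type _ :=
  {p : ℕ → Set Z // (∀ n, p n ∈ V n) ∧ ∀ n, p (n + 1) ⊆ p n}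

/-- The cylinder-set topology on the path space, i.e. the subspace topology from
the product of the (finite, discrete) vertex sets. -/
instance {Z : Type*} (V : ℕ → Set (Set Z)) : TopologicalSpace (ApproxPath V) :=
  TopologicalSpace.generateFrom
    {C | ∃ (m : ℕ) (q : ApproxPath V), C = {p : ApproxPath V | ∀ n ≤ m, p.1 n = q.1 n}}

/-- The union of the overlapping set `𝒴_n`: points lying in the closures of two
distinct elements of `V n`. -/
def overlapSet {Z : Type*} [TopologicalSpace Z] (V : ℕ → Set (Set Z)) (n : ℕ) : Set Z :=
  {z | ∃ v ∈ V n, ∃ w ∈ V n, v ≠ w ∧ z ∈ closure v ∩ closure w}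

/-- The essential part `v^ess = int(v) \ ⋃ 𝒴_n` of `v ∈ V n`. -/
def essPart {Z : Type*} [TopologicalSpace Z] (V : ℕ → Set (Set Z)) (n : ℕ)
    (v : Set Z) : Set Z :=
  interior v \ overlapSet V n

theorem approx_isBasis {Z : Type*} (V : ℕ → Set (Set Z)) :
    TopologicalSpace.IsTopologicalBasis
      {C | ∃ (m : ℕ) (q : ApproxPath V), C = {p : ApproxPath V | ∀ n ≤ m, p.1 n = q.1 n}} where
  exists_subset_inter := by
    rintro _ ⟨m, q, rfl⟩ _ ⟨m', q', rfl⟩ x ⟨hx, hx'⟩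
    refine ⟨_, ⟨max m m', x, rfl⟩, fun n _ => rfl, fun y hy => ⟨fun n hn => ?_, fun n hn => ?_⟩⟩
    · rw [hy n (le_max_of_le_left hn), hx n hn]
    · rw [hy n (le_max_of_le_right hn), hx' n hn]
  sUnion_eq := by
    refine eq_univ_of_forall fun x => ⟨_, ⟨0, x, rfl⟩, fun n _ => rfl⟩
  eq_generateFrom := rfl

theorem approx_anti {Z : Type*} {V : ℕ → Set (Set Z)} (p : ApproxPath V) {n m : ℕ}
    (h : n ≤ m) : p.1 m ⊆ p.1 n :=
  antitone_nat_of_succ_le (f := p.1) p.2.2 h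

theorem approx_up {Z : Type*} (V : ℕ → Set (Set Z))
    (hnested : ∀ n, ∀ w ∈ V (n + 1), ∃ v ∈ V n, w ⊆ v) (n : ℕ) :
    ∀ f : ℕ → Set Z, (∀ k, f k ∈ V (n + k)) → (∀ k, f (k + 1) ⊆ f k) →
      ∃ q : ApproxPath V, ∀ k, q.1 (n + k) = f k := by
  induction n with
  | zero =>
    intro f h1 h2
    exact ⟨⟨f, fun n => by simpa using h1 n, h2⟩, fun k => by simp⟩
  | succ n ih =>
    intro f h1 h2
    obtain ⟨v, hv, hsub⟩ := hnested n (f 0) (h1 0)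
    obtain ⟨q, hq⟩ := ih (fun k => Nat.casesOn k v f)
      (by
        intro k
        cases k with
        | zero => exact hv
        | succ k =>
          have := h1 k
          rw [show n + 1 + k = n + (k + 1) by omega] at this
          exact this)
      (by
        intro k
        cases k with
        | zero => exact hsub
        | succ k => exact h2 k)
    refine ⟨q, fun k => ?_⟩
    rw [show n + 1 + k = n + (k + 1) by omega]
    exact hq (k + 1)

theorem approx_through {Z : Type*} (V : ℕ → Set (Set Z))
    (hnested : ∀ n, ∀ w ∈ V (n + 1), ∃ v ∈ V n, w ⊆ v)
    (hreg : ∀ n, ∀ v ∈ V n, v = ⋃₀ {w ∈ V (n + 1) | w ⊆ v})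
    (z : Z) (n : ℕ) (w : Set Z) (hw : w ∈ V n) (hz : z ∈ w) :
    ∃ q : ApproxPath V, q.1 n = w ∧ ∀ k, z ∈ q.1 k := by
  have step : ∀ n v, ∃ w, v ∈ V n → z ∈ v → w ∈ V (n + 1) ∧ w ⊆ v ∧ z ∈ w := by
    intro n v
    by_cases h : v ∈ V n ∧ z ∈ v
    · have h2 := h.2
      rw [hreg n v h.1] at h2
      obtain ⟨w, ⟨hw, hwv⟩, hzw⟩ := h2
      exact ⟨w, fun _ _ => ⟨hw, hwv, hzw⟩⟩
    · exact ⟨v, fun a b => absurd ⟨a, b⟩ h⟩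
  choose g hg using step
  let f : ℕ → Set Z := fun k => Nat.rec w (fun k v => g (n + k) v) k
  have hf : ∀ k, f k ∈ V (n + k) ∧ z ∈ f k := by
    intro k
    induction k with
    | zero => exact ⟨hw, hz⟩
    | succ k ih =>
      have := hg (n + k) (f k) ih.1 ih.2
      exact ⟨this.1, this.2.2⟩
  obtain ⟨q, hq⟩ := approx_up V hnested n f (fun k => (hf k).1)
    (fun k => (hg (n + k) (f k) (hf k).1 (hf k).2).2.1)
  refine ⟨q, hq 0, fun k => ?_⟩
  have : z ∈ q.1 (n + k) := by rw [hq k]; exact (hf k).2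
  exact approx_anti q (by omega) this

/-- For an essential refining sequence of finite closed covers of a compact
metric space, the set of paths that are the unique path over their image point
is a dense `Gδ` subset of the path space. -/
theorem essential_injectivity_set_dense_Gδ {Z : Type*} [MetricSpace Z]
    [CompactSpace Z] (V : ℕ → Set (Set Z))
    (hfin : ∀ n, (V n).Finite)
    (hclosed : ∀ n, ∀ v ∈ V n, IsClosed v ∧ (interior v).Nonempty)
    (hzero : V 0 = {Set.univ})
    (hcover : ∀ n, ⋃₀ V n = Set.univ)
    (hnested : ∀ n, ∀ w ∈ V (n + 1), ∃ v ∈ V n, w ⊆ v)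
    (hdiam : ∀ ε : ℝ, 0 < ε → ∃ N : ℕ, ∀ n ≥ N, ∀ v ∈ V n, diam v ≤ ε)
    (hregular : ∀ n, ∀ v ∈ V n,
      v = ⋃₀ {w ∈ V (n + 1) | w ⊆ v} ∧ (essPart V n v).Nonempty)
    (hessential : ∀ n, Dense (⋃ v ∈ V n, essPart V n v))
    (π : ApproxPath V → Z)
    (hπ : ∀ p : ApproxPath V, (⋂ n, closure (p.1 n)) = {π p}) :
    Dense {p : ApproxPath V | ∀ q : ApproxPath V, π q = π p → q = p} ∧
      IsGδ {p : ApproxPath V | ∀ q : ApproxPath V, π q = π p → q = p} := by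
  have hmem : ∀ (p : ApproxPath V) n, π p ∈ p.1 n := by
    intro p n
    have : π p ∈ ⋂ n, closure (p.1 n) := by rw [hπ]; rfl
    have := mem_iInter.1 this n
    rwa [(hclosed n _ (p.2.1 n)).1.closure_eq] at this
  have hpi : ∀ (p : ApproxPath V) z, (∀ n, z ∈ p.1 n) → π p = z := by
    intro p z hz
    have : z ∈ ⋂ n, closure (p.1 n) := mem_iInter.2 fun n => subset_closure (hz n)
    rw [hπ] at this
    exact (mem_singleton_iff.1 this).symm
  have hover : ∀ n, IsClosed (overlapSet V n) := by
    intro n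
    have : overlapSet V n =
        ⋃ v ∈ V n, ⋃ w ∈ {w ∈ V n | v ≠ w}, (closure v ∩ closure w) := by
      ext z
      simp only [overlapSet, mem_setOf_eq, mem_iUnion, exists_prop, and_assoc]
    rw [this]
    refine (hfin n).isClosed_biUnion fun v _ => ?_
    exact ((hfin n).subset (sep_subset _ _)).isClosed_biUnion fun w _ =>
      isClosed_closure.inter isClosed_closure
  have hess : ∀ n v, IsOpen (essPart V n v) := fun n v => isOpen_interior.sdiff (hover n)
  have huniq : ∀ n z, z ∉ overlapSet V n → ∀ v ∈ V n, ∀ w ∈ V n, z ∈ v → z ∈ w → v = w := by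
    intro n z hz v hv w hw hzv hzw
    by_contra hne
    exact hz ⟨v, hv, w, hw, hne, subset_closure hzv, subset_closure hzw⟩
  constructor
  · rw [(approx_isBasis V).dense_iff]
    rintro _ ⟨m, p, rfl⟩ -
    have hD : Dense (⋂ n, ⋃ v ∈ V n, essPart V n v) :=
      dense_iInter_of_isOpen (fun n => isOpen_biUnion fun v _ => hess n v) hessential
    obtain ⟨z, hzm, hzD⟩ := hD.inter_open_nonempty _ (hess m (p.1 m))
      (hregular m _ (p.2.1 m)).2
    have hzo : ∀ n, z ∉ overlapSet V n := by
      intro n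
      have := mem_iInter.1 hzD n
      simp only [mem_iUnion] at this
      obtain ⟨v, _, h⟩ := this
      exact h.2
    have hzp : z ∈ p.1 m := interior_subset hzm.1
    obtain ⟨q, hqm, hq⟩ := approx_through V hnested (fun n v hv => (hregular n v hv).1) z m
      (p.1 m) (p.2.1 m) hzp
    refine ⟨q, fun n hn => ?_, fun q' hq' => ?_⟩
    · exact huniq n z (hzo n) _ (q.2.1 n) _ (p.2.1 n) (hq n) (approx_anti p hn hzp)
    · rw [hpi q z hq] at hq'
      refine Subtype.ext (funext fun n => ?_)
      exact huniq n z (hzo n) _ (q'.2.1 n) _ (q.2.1 n) (hq' ▸ hmem q' n) (hq n)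
  · have hI : {p : ApproxPath V | ∀ q : ApproxPath V, π q = π p → q = p} =
        ⋂ n, {p : ApproxPath V | ∀ w ∈ V n, π p ∈ w → w = p.1 n} := by
      ext p
      simp only [mem_setOf_eq, mem_iInter]
      constructor
      · intro h n w hw hz
        obtain ⟨q, hqn, hq⟩ := approx_through V hnested (fun n v hv => (hregular n v hv).1)
          (π p) n w hw hz
        rw [← hqn, h q (hpi q _ hq)]
      · intro h q hqp
        exact Subtype.ext (funext fun n => h n _ (q.2.1 n) (hqp ▸ hmem q n))
    rw [hI]
    refine IsGδ.iInter_of_isOpen fun n => ?_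
    rw [(approx_isBasis V).isOpen_iff]
    intro p hp
    have hK : IsClosed (⋃ w ∈ {w ∈ V n | w ≠ p.1 n}, w) :=
      ((hfin n).subset (sep_subset _ _)).isClosed_biUnion fun w hw => (hclosed n w hw.1).1
    have hpK : π p ∈ (⋃ w ∈ {w ∈ V n | w ≠ p.1 n}, w)ᶜ := by
      simp only [mem_compl_iff, mem_iUnion, not_exists]
      intro w hw hz
      exact hw.2 (hp w hw.1 hz)
    obtain ⟨ε, hε, hball⟩ := Metric.isOpen_iff.1 hK.isOpen_compl _ hpK
    obtain ⟨N, hN⟩ := hdiam (ε / 2) (by positivity)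
    refine ⟨_, ⟨max n N, p, rfl⟩, fun k _ => rfl, fun p' hp' w hw hz => ?_⟩
    rw [hp' n (le_max_left _ _)]
    by_contra hne
    have h1 : π p' ∈ p.1 (max n N) := by
      rw [← hp' _ le_rfl]; exact hmem p' _
    have h2 : dist (π p') (π p) ≤ ε / 2 :=
      (dist_le_diam_of_mem (isCompact_univ.isBounded.subset (subset_univ _)) h1 (hmem p _)).trans
        (hN _ (le_max_right _ _) _ (p.2.1 _))
    exact hball (show π p' ∈ ball (π p) ε by rw [mem_ball]; linarith)
      (mem_biUnion (show w ∈ {w ∈ V n | w ≠ p.1 n} from ⟨hw, hne⟩) hz)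
end

section
/- Let (Z,d) be a compact metric space admitting a homogeneous approximation graph, i.e. a refining sequence (𝒱_n)_{n≥0} of finite open covers together with constants λ > 1, 0 < η ≤ θ and C_Γ, N_Γ ∈ ℕ such that for all n ≥ 1: (i) max_{V ∈ 𝒱_n} diam(V) ≤ λ^{-n+1}θ; (ii) the Lebesgue covering number Leb(𝒱_n) = min_{z∈Z} max_{V∈𝒱_n} d(z, Z\V) satisfies Leb(𝒱_n) ≥ λ^{-n+1}η; (iii) every V ∈ 𝒱_n contains at most C_Γ elements of 𝒱_{n+1}; (iv) #{W ∈ 𝒱_n : W ∩ V ≠ ∅} ≤ N_Γ for every V ∈ 𝒱_n. Then Z has finite Assouad dimension: there exist C ≥ 0 and s ≥ 0 such that for all 0 < a ≤ b and every finite subset Y ⊆ Z with a ≤ d(y,y') ≤ b for all distinct y,y' ∈ Y, one has #Y ≤ C·(b/a)^s. -/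
open Set Metric Topology

theorem haux_step {Z : Type*} (V : ℕ → Set (Set Z)) (CG : ℕ)
    (hfin : ∀ n, (V n).Finite)
    (hnested : ∀ n, ∀ w ∈ V (n + 1), ∃ v ∈ V n, w ⊆ v)
    (hdesc : ∀ n ≥ 1, ∀ v ∈ V n, ({w ∈ V (n + 1) | w ⊆ v}).ncard ≤ CG)
    (Y : Set Z) (n : ℕ) (hn : 1 ≤ n) (k : ℕ) :
    ({w ∈ V (n + k) | (w ∩ Y).Nonempty}).ncard
      ≤ ({w ∈ V n | (w ∩ Y).Nonempty}).ncard * CG ^ k := by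
  classical
  induction k with
  | zero => simp
  | succ k ih =>
    have hf : ({w ∈ V (n + k) | (w ∩ Y).Nonempty}).Finite := (hfin _).subset (sep_subset _ _)
    have hsub : {w ∈ V (n + k + 1) | (w ∩ Y).Nonempty} ⊆
        ⋃ v ∈ hf.toFinset, {w ∈ V (n + k + 1) | w ⊆ v} := by
      rintro w ⟨hw, hwY⟩
      obtain ⟨v, hv, hwv⟩ := hnested _ w hw
      simp only [mem_iUnion]
      exact ⟨v, by simpa using ⟨hv, hwY.mono (inter_subset_inter_left _ hwv)⟩, hw, hwv⟩
    have h1 := ncard_le_ncard hsub ((hfin (n + k + 1)).subset (by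
      intro w hw
      simp only [mem_iUnion] at hw
      obtain ⟨_, _, h, _⟩ := hw
      exact h))
    have h2 : (⋃ v ∈ hf.toFinset, {w ∈ V (n + k + 1) | w ⊆ v}).ncard
        ≤ ∑ v ∈ hf.toFinset, ({w ∈ V (n + k + 1) | w ⊆ v}).ncard :=
      Finset.set_ncard_biUnion_le _ _
    have h3 : ∑ v ∈ hf.toFinset, ({w ∈ V (n + k + 1) | w ⊆ v}).ncard
        ≤ hf.toFinset.card * CG := by
      rw [← smul_eq_mul]
      apply Finset.sum_le_card_nsmul
      intro v hv
      have hv' := hf.mem_toFinset.1 hv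
      exact hdesc _ (by omega) v hv'.1
    rw [← ncard_eq_toFinset_card _ hf] at h3
    calc _ ≤ _ := h1.trans (h2.trans h3)
      _ ≤ _ := Nat.mul_le_mul_right CG ih
      _ = _ := by rw [pow_succ, mul_assoc]

/-- A compact metric space admitting a homogeneous approximation graph, i.e. a
refining sequence of finite open covers whose diameters decay like `λ^{-n+1}θ`,
whose Lebesgue numbers decay no faster than `λ^{-n+1}η`, with a uniform bound
`C_Γ` on the number of descendants and a uniform bound `N_Γ` on the number of
neighbours, has finite Assouad dimension. -/
theorem homogeneous_approximation_graph_finite_assouad {Z : Type*}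
    [MetricSpace Z] [CompactSpace Z] (V : ℕ → Set (Set Z))
    (lam θ η : ℝ) (CG NG : ℕ)
    (hlam : 1 < lam) (hη : 0 < η) (hθ : η ≤ θ)
    (hfin : ∀ n, (V n).Finite)
    (hopen : ∀ n, ∀ v ∈ V n, IsOpen v)
    (hzero : V 0 = {Set.univ})
    (hcover : ∀ n, ⋃₀ V n = Set.univ)
    (hnested : ∀ n, ∀ w ∈ V (n + 1), ∃ v ∈ V n, w ⊆ v)
    (hdiam : ∀ n ≥ 1, ∀ v ∈ V n, diam v ≤ lam ^ (1 - (n : ℤ)) * θ)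
    (hleb : ∀ n ≥ 1, ∀ z : Z, ∃ v ∈ V n, ball z (lam ^ (1 - (n : ℤ)) * η) ⊆ v)
    (hdesc : ∀ n ≥ 1, ∀ v ∈ V n, ({w ∈ V (n + 1) | w ⊆ v}).ncard ≤ CG)
    (hnbr : ∀ n ≥ 1, ∀ v ∈ V n, ({w ∈ V n | (w ∩ v).Nonempty}).ncard ≤ NG) :
    ∃ C s : ℝ, 0 ≤ C ∧ 0 ≤ s ∧ ∀ a b : ℝ, 0 < a → a ≤ b → ∀ Y : Finset Z,
      (∀ y ∈ Y, ∀ y' ∈ Y, y ≠ y' → a ≤ dist y y' ∧ dist y y' ≤ b) →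
      (Y.card : ℝ) ≤ C * (b / a) ^ s := by
  classical
  have hl0 : 0 < lam := by linarith
  have hθ0 : 0 < θ := by linarith
  have hl2 : 1 ≤ lam ^ 2 := one_le_pow₀ hlam.le
  set N : ℕ := max NG (V 1).ncard with hN
  set D : ℝ := max (CG : ℝ) 1 with hD
  have hD1 : 1 ≤ D := le_max_right _ _
  set s : ℝ := Real.logb lam D with hs
  have hs0 : 0 ≤ s := Real.logb_nonneg hlam hD1
  have hlD : lam ^ s = D := Real.rpow_logb hl0 hlam.ne' (by linarith)
  set K : ℝ := lam ^ 2 * θ / η with hK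
  have hK1 : 1 ≤ K := by
    rw [hK, le_div_iff₀ hη]
    nlinarith [mul_le_mul_of_nonneg_right hl2 hθ0.le]
  refine ⟨N * D * K ^ s, s, by positivity, hs0, ?_⟩
  intro a b ha hab Y hY
  have hb : 0 < b := by linarith
  rcases Y.eq_empty_or_nonempty with rfl | ⟨y0, hy0⟩
  · simp only [Finset.card_empty, Nat.cast_zero]; positivity
  have hstart : ∃ n : ℕ, 1 ≤ n ∧ ({w ∈ V n | (w ∩ (Y : Set Z)).Nonempty}).ncard ≤ N ∧
      lam ^ (1 - (n : ℤ)) * η ≤ lam ^ 2 * b := by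
    have hone : η ≤ lam ^ 2 * b → ∃ n : ℕ, 1 ≤ n ∧
      ({w ∈ V n | (w ∩ (Y : Set Z)).Nonempty}).ncard ≤ N ∧
      lam ^ (1 - (n : ℤ)) * η ≤ lam ^ 2 * b := by
      intro h
      refine ⟨1, le_rfl, (ncard_le_ncard (sep_subset _ _) (hfin 1)).trans (le_max_right _ _), ?_⟩
      simpa using h
    by_cases h : η ≤ b
    · exact hone (by nlinarith [mul_le_mul_of_nonneg_right hl2 hb.le])
    push Not at h
    obtain ⟨i, hi1, hi2⟩ := exists_nat_pow_near ((one_le_div hb).2 h.le) hlam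
    rw [le_div_iff₀ hb] at hi1
    rw [div_lt_iff₀ hb] at hi2
    rcases Nat.eq_zero_or_pos i with rfl | hi
    · apply hone
      simp only [zero_add, pow_one] at hi2
      nlinarith [mul_pos hl0 hb]
    · have hz : lam ^ (1 - (i : ℤ)) = lam / lam ^ i := by
        rw [zpow_sub₀ hl0.ne']; simp
      have hp : 0 < lam ^ i := by positivity
      refine ⟨i, hi, ?_, ?_⟩
      · obtain ⟨v, hv, hbv⟩ := hleb i hi y0
        have hYv : (Y : Set Z) ⊆ v := by
          intro y hy
          apply hbv
          have hyb : dist y y0 ≤ b := by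
            by_cases e : y = y0
            · subst e; simpa using hb.le
            · exact (hY y hy y0 hy0 e).2
          rw [mem_ball, hz, div_mul_eq_mul_div, lt_div_iff₀ hp]
          have : dist y y0 * lam ^ i ≤ b * lam ^ i := by gcongr
          nlinarith
        refine le_trans (ncard_le_ncard ?_ ((hfin i).subset (sep_subset _ _)))
          ((hnbr i hi v hv).trans (le_max_left _ _))
        rintro w ⟨hw, hwY⟩
        exact ⟨hw, hwY.mono (inter_subset_inter_right _ hYv)⟩
      · rw [hz, div_mul_eq_mul_div, div_le_iff₀ hp]
        rw [pow_succ] at hi2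
        nlinarith
  obtain ⟨n, hn, hnN, hnb⟩ := hstart
  have hba : 1 ≤ b / a := (one_le_div ha).2 hab
  obtain ⟨j, hj1, hj2⟩ := exists_nat_pow_near (one_le_mul_of_one_le_of_one_le hK1 hba) hlam
  have hsmall : lam ^ (1 - ((n + (j + 1) : ℕ) : ℤ)) * θ < a := by
    have hz : lam ^ (1 - ((n + (j + 1) : ℕ) : ℤ)) = lam ^ (1 - (n : ℤ)) / lam ^ (j + 1) := by
      rw [← zpow_natCast, ← zpow_sub₀ hl0.ne']; congr 1; push_cast; ring
    rw [hz, div_mul_eq_mul_div, div_lt_iff₀ (by positivity)]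
    have e1 : K * (b / a) * a = lam ^ 2 * b / η * θ := by rw [hK]; field_simp
    have e2 : lam ^ (1 - (n : ℤ)) ≤ lam ^ 2 * b / η := (le_div_iff₀ hη).2 hnb
    have e3 := mul_lt_mul_of_pos_right hj2 ha
    have e4 := mul_le_mul_of_nonneg_right e2 hθ0.le
    linarith
  have hcard : Y.card ≤ ({w ∈ V (n + (j + 1)) | (w ∩ (Y : Set Z)).Nonempty}).ncard := by
    have hex : ∀ y : Z, ∃ w ∈ V (n + (j + 1)), y ∈ w := by
      intro y
      have : y ∈ ⋃₀ V (n + (j + 1)) := by rw [hcover]; trivial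
      simpa using this
    choose f hf1 hf2 using hex
    rw [← ncard_coe_finset]
    refine ncard_le_ncard_of_injOn f (fun y hy => ⟨hf1 y, y, hf2 y, hy⟩) ?_
      ((hfin _).subset (sep_subset _ _))
    intro y hy y' hy' e
    by_contra hne
    have h1 := (hY y hy y' hy' hne).1
    have h2 := dist_le_diam_of_mem (isBounded_of_compactSpace (s := f y)) (hf2 y) (e ▸ hf2 y')
    have h3 := hdiam (n + (j + 1)) (by omega) (f y) (hf1 y)
    linarith
  have hmain : Y.card ≤ N * CG ^ (j + 1) :=
    hcard.trans ((haux_step V CG hfin hnested hdesc Y n hn (j + 1)).trans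
      (Nat.mul_le_mul_right _ hnN))
  have hDj : D ^ j ≤ K ^ s * (b / a) ^ s := by
    have e : D ^ j = (lam ^ j) ^ s := by
      calc D ^ j = (lam ^ s) ^ j := by rw [hlD]
        _ = (lam ^ j) ^ s := by
          rw [← Real.rpow_natCast, ← Real.rpow_mul hl0.le, mul_comm, Real.rpow_mul hl0.le,
            Real.rpow_natCast]
    rw [← Real.mul_rpow (by linarith) (by linarith), e]
    exact Real.rpow_le_rpow (by positivity) hj1 hs0
  calc (Y.card : ℝ) ≤ N * (CG : ℝ) ^ (j + 1) := by exact_mod_cast hmain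
    _ ≤ N * D ^ (j + 1) := by gcongr; exact le_max_left _ _
    _ = N * D * D ^ j := by ring
    _ ≤ N * D * (K ^ s * (b / a) ^ s) := by gcongr
    _ = _ := by ring
end

section
/- Let (X,d,φ) be a Smale space with constants ε'_X and ε''_X as specified, and let ℛ₁ be a Markov partition of X with diam(R) ≤ ε''_X for every R ∈ ℛ₁. (1) If R_i, R_j ∈ ℛ₁ satisfy int(R_i) ∩ φ^{-1}(int(R_j)) ≠ ∅, then {[x,y] : x ∈ φ^{-1}(R_j), y ∈ R_i} = R_i ∩ φ^{-1}(R_j), and consequently R_i ∩ φ^{-1}(R_j) is a proper rectangle. (2) If R_i, R_j, R_k ∈ ℛ₁ satisfy φ(int(R_i)) ∩ int(R_j) ∩ φ^{-1}(int(R_k)) ≠ ∅, then {[x,y] : x ∈ φ^{-1}(R_k), y ∈ φ(R_i)} = φ(R_i) ∩ R_j ∩ φ^{-1}(R_k); consequently φ(R_i) ∩ R_j ∩ φ^{-1}(R_k) is a proper rectangle equal to φ(R_i) ∩ φ^{-1}(R_k). -/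
open Set Metric MeasureTheory Topology
open scoped ENNReal NNReal

/-- A dynamical system is irreducible if for every ordered pair of nonempty open
sets `U, V` there is `n : ℕ` with `ψ^[n] '' U ∩ V ≠ ∅`. -/
def IrreducibleSystem {Z : Type*} [TopologicalSpace Z] (ψ : Z → Z) : Prop :=
  ∀ U V : Set Z, IsOpen U → IsOpen V → U.Nonempty → V.Nonempty →
    ∃ n : ℕ, (ψ^[n] '' U ∩ V).Nonempty

/-- A dynamical system is mixing if for every ordered pair of nonempty open sets
`U, V` there is `N : ℕ` with `ψ^[n] '' U ∩ V ≠ ∅` for all `n ≥ N`. -/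
def MixingSystem {Z : Type*} [TopologicalSpace Z] (ψ : Z → Z) : Prop :=
  ∀ U V : Set Z, IsOpen U → IsOpen V → U.Nonempty → V.Nonempty →
    ∃ N : ℕ, ∀ n ≥ N, (ψ^[n] '' U ∩ V).Nonempty

/-- The (possibly infinite) Lipschitz constant of a map between metric spaces. -/
noncomputable def lipConst {X : Type*} [PseudoEMetricSpace X] (f : X → X) : ℝ≥0∞ :=
  sInf {K : ℝ≥0∞ | ∀ x y : X, edist (f x) (f y) ≤ K * edist x y}

/-- A measure on a metric space is Ahlfors `s`-regular if closed balls of radius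
`r < diam Z` have measure comparable to `r ^ s`. -/
def AhlforsRegular {Z : Type*} [MetricSpace Z] [MeasurableSpace Z]
    (μ : Measure Z) (s : ℝ) : Prop :=
  0 < s ∧ ∃ C : ℝ, 0 < C ∧ ∀ (z : Z) (r : ℝ), 0 ≤ r → r < diam (Set.univ : Set Z) →
    ENNReal.ofReal (C⁻¹ * r ^ s) ≤ μ (closedBall z r) ∧
    μ (closedBall z r) ≤ ENNReal.ofReal (C * r ^ s)

/-- A Smale space: a compact metric space together with a homeomorphism `phi`,
constants `eps > 0`, `lam > 1` and a partially defined continuous bracket map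
satisfying the bracket axioms and the contraction axioms. -/
structure SmaleSpace (X : Type*) [MetricSpace X] where
  phi : Equiv.Perm X
  phi_cont : Continuous phi
  phi_symm_cont : Continuous phi.symm
  eps : ℝ
  lam : ℝ
  eps_pos : 0 < eps
  one_lt_lam : 1 < lam
  bracket : X → X → X
  bracket_cont : ContinuousOn (fun p : X × X => bracket p.1 p.2)
    {p : X × X | dist p.1 p.2 ≤ eps}
  bracket_self : ∀ x : X, bracket x x = x
  bracket_assoc₁ : ∀ x y z : X, dist y z ≤ eps → dist x (bracket y z) ≤ eps →
    dist x z ≤ eps → bracket x (bracket y z) = bracket x z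
  bracket_assoc₂ : ∀ x y z : X, dist x y ≤ eps → dist (bracket x y) z ≤ eps →
    dist x z ≤ eps → bracket (bracket x y) z = bracket x z
  bracket_phi : ∀ x y : X, dist x y ≤ eps → dist (phi x) (phi y) ≤ eps →
    phi (bracket x y) = bracket (phi x) (phi y)
  contract_s : ∀ (x : X) (ε : ℝ), 0 < ε → ε ≤ eps → ∀ y z : X,
    dist x y < ε → bracket x y = y → dist x z < ε → bracket x z = z →
    dist (phi y) (phi z) ≤ lam⁻¹ * dist y z
  contract_u : ∀ (x : X) (ε : ℝ), 0 < ε → ε ≤ eps → ∀ y z : X,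
    dist x y < ε → bracket y x = y → dist x z < ε → bracket z x = z →
    dist (phi.symm y) (phi.symm z) ≤ lam⁻¹ * dist y z

namespace SmaleSpace

variable {X : Type*} [MetricSpace X] (S : SmaleSpace X)

/-- The local stable set `X^s(x, ε)`. -/
def stable (x : X) (ε : ℝ) : Set X := {y | dist x y < ε ∧ S.bracket x y = y}

/-- The local unstable set `X^u(x, ε)`. -/
def unstable (x : X) (ε : ℝ) : Set X := {y | dist x y < ε ∧ S.bracket y x = y}

/-- A rectangle (relative to the constant `ε'`): a nonempty set of diameter at
most `ε'` closed under the bracket. -/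
def IsRectangle (ε' : ℝ) (R : Set X) : Prop :=
  R.Nonempty ∧ diam R ≤ ε' ∧ ∀ x ∈ R, ∀ y ∈ R, S.bracket x y ∈ R

/-- A proper rectangle: a closed rectangle equal to the closure of its interior. -/
def IsProperRectangle (ε' : ℝ) (R : Set X) : Prop :=
  S.IsRectangle ε' R ∧ IsClosed R ∧ R = closure (interior R)

/-- `X^s(x, R) = X^s(x, 2ε') ∩ R`. -/
def stableIn (ε' : ℝ) (x : X) (R : Set X) : Set X := S.stable x (2 * ε') ∩ R

/-- `X^u(x, R) = X^u(x, 2ε') ∩ R`. -/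
def unstableIn (ε' : ℝ) (x : X) (R : Set X) : Set X := S.unstable x (2 * ε') ∩ R

/-- A Markov partition: a finite cover by nonempty proper rectangles with
pairwise disjoint interiors, satisfying the Markov conditions. -/
def IsMarkovPartition (ε' : ℝ) (P : Set (Set X)) : Prop :=
  P.Finite ∧ ⋃₀ P = Set.univ ∧
  (∀ R ∈ P, S.IsProperRectangle ε' R) ∧
  (∀ R ∈ P, ∀ R' ∈ P, R ≠ R' → interior R ∩ interior R' = ∅) ∧
  (∀ R ∈ P, ∀ R' ∈ P, ∀ x : X, x ∈ interior R → S.phi x ∈ interior R' →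
    S.unstableIn ε' (S.phi x) R' ⊆ S.phi '' (S.unstableIn ε' x R) ∧
    S.phi '' (S.stableIn ε' x R) ⊆ S.stableIn ε' (S.phi x) R')

/-- The refining sequence of Markov partitions
`ℛ_n = {⋂_{i=1-n}^{n-1} φ^{-i}(R_{x_i}) : R_{x_i} ∈ ℛ₁, int ≠ ∅}`, with
`ℛ₀ = {X}`. -/
def markovSeq (P : Set (Set X)) : ℕ → Set (Set X)
  | 0 => {Set.univ}
  | (n + 1) => {R | (interior R).Nonempty ∧ ∃ g : ℤ → Set X, (∀ i : ℤ, g i ∈ P) ∧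
      R = ⋂ i ∈ Finset.Icc (-(n : ℤ)) (n : ℤ), (⇑(S.phi ^ i)) ⁻¹' (g i)}

end SmaleSpace

/-- `N_𝒰(Y)`: the elements of the cover `𝒰` meeting the set `Y`. -/
def nbr {X : Type*} (U : Set (Set X)) (Y : Set X) : Set (Set X) :=
  {u ∈ U | (u ∩ Y).Nonempty}

/-- The property defining the constant `ε'_X` of a Smale space. -/
def SmaleSpace.epsOne {X : Type*} [MetricSpace X] (S : SmaleSpace X) (ε' : ℝ) : Prop :=
  0 < ε' ∧ ε' ≤ S.eps / 2 ∧ ∀ x y : X, dist x y ≤ ε' →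
    dist x (S.bracket x y) < S.eps / 2 ∧ dist y (S.bracket x y) < S.eps / 2

/-- The property defining the constant `ε''_X` of a Smale space. -/
def SmaleSpace.epsTwo {X : Type*} [MetricSpace X] (S : SmaleSpace X) (ε' ε'' : ℝ) : Prop :=
  0 < ε'' ∧ ε'' < ε' / 12 ∧ ∀ x y : X, dist x y ≤ ε'' →
    (∀ i : ℤ, |i| ≤ 2 → dist ((S.phi ^ i) x) ((S.phi ^ i) y) ≤ ε' / 2) ∧
    dist (S.bracket x y) x ≤ ε' / 4 ∧ dist (S.bracket x y) y ≤ ε' / 4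

open Set Metric Topology
open scoped ENNReal

namespace SmaleSpace

lemma bracket_contAt {X : Type*} [MetricSpace X] (S : SmaleSpace X) {x y : X}
    (h : dist x y < S.eps) : ContinuousAt (fun p : X × X => S.bracket p.1 p.2) (x, y) := by
  apply S.bracket_cont.continuousAt
  have : IsOpen {p : X × X | dist p.1 p.2 < S.eps} :=
    isOpen_lt (continuous_fst.dist continuous_snd) continuous_const
  exact Filter.mem_of_superset (this.mem_nhds h) (fun p (hp : dist p.1 p.2 < S.eps) => show dist p.1 p.2 ≤ S.eps from hp.le)

lemma image2_nhds {X : Type*} [MetricSpace X] (S : SmaleSpace X) {ε' : ℝ}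
    (hε' : S.epsOne ε') {U V : Set X} (hU : IsOpen U) (hV : IsOpen V) {x y : X}
    (hx : x ∈ U) (hy : y ∈ V) (hxy : dist x y ≤ ε') :
    Set.image2 S.bracket U V ∈ 𝓝 (S.bracket x y) := by
  obtain ⟨h0, h1, h2⟩ := hε'
  obtain ⟨hpx, hpy⟩ := h2 x y hxy
  have he := S.eps_pos
  set p := S.bracket x y with hp
  have hxye : dist x y ≤ S.eps := by linarith
  have e1 : S.bracket p x = x := by
    rw [hp, S.bracket_assoc₂ x y x hxye (by rw [← hp, dist_comm]; linarith)
      (by rw [dist_self]; linarith), S.bracket_self]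
  have e2 : S.bracket y p = y := by
    rw [hp, S.bracket_assoc₁ y x y hxye (by rw [← hp]; linarith)
      (by rw [dist_self]; linarith), S.bracket_self]
  have c1 : ContinuousAt (fun q => S.bracket q x) p :=
    ContinuousAt.comp (f := fun q : X => (q, x))
      (S.bracket_contAt (by rw [dist_comm]; linarith)) (by fun_prop)
  have c2 : ContinuousAt (fun q => S.bracket y q) p :=
    ContinuousAt.comp (f := fun q : X => (y, q))
      (S.bracket_contAt (by linarith)) (by fun_prop)
  have m1 : ∀ᶠ q in 𝓝 p, S.bracket q x ∈ U := c1.eventually_mem (by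
    rw [e1]; exact hU.mem_nhds hx)
  have m2 : ∀ᶠ q in 𝓝 p, S.bracket y q ∈ V := c2.eventually_mem (by
    rw [e2]; exact hV.mem_nhds hy)
  have d1 : ∀ᶠ q in 𝓝 p, dist q x < S.eps :=
    (continuousAt_id.dist continuousAt_const).eventually_lt_const (by
      simp only [id]; rw [dist_comm]; linarith)
  have d2 : ∀ᶠ q in 𝓝 p, dist y q < S.eps :=
    (continuousAt_const.dist continuousAt_id).eventually_lt_const (by
      simp only [id]; linarith)
  have d3 : ∀ᶠ q in 𝓝 p, dist (S.bracket q x) (S.bracket y q) < S.eps :=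
    (c1.dist c2).eventually_lt_const (by simp only [e1, e2]; linarith)
  have d4 : ∀ᶠ q in 𝓝 p, dist q (S.bracket y q) < S.eps :=
    (continuousAt_id.dist c2).eventually_lt_const (by
      simp only [id]; rw [e2, dist_comm]; linarith)
  filter_upwards [m1, m2, d1, d2, d3, d4] with q m1 m2 d1 d2 d3 d4
  refine ⟨_, m1, _, m2, ?_⟩
  rw [S.bracket_assoc₂ _ _ _ d1.le d3.le d4.le, S.bracket_assoc₁ _ _ _ d2.le d4.le
    (by rw [dist_self]; linarith), S.bracket_self]

lemma subset_closure_interior {X : Type*} [MetricSpace X] (S : SmaleSpace X) {ε' : ℝ}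
    (hε' : S.epsOne ε') {A B : Set X} (hA : A ⊆ closure (interior A))
    (hB : B ⊆ closure (interior B)) (hd : ∀ a ∈ A, ∀ b ∈ B, dist a b ≤ ε')
    {C : Set X} (hC : Set.image2 S.bracket A B = C) (hCA : C ⊆ A) (hCB : C ⊆ B) :
    C ⊆ closure (interior C) := by
  intro w hw
  rw [mem_closure_iff_nhds]
  intro t ht
  have hc : ContinuousAt (fun p : X × X => S.bracket p.1 p.2) (w, w) :=
    S.bracket_contAt (by rw [dist_self]; exact S.eps_pos)
  have hm : (fun p : X × X => S.bracket p.1 p.2) ⁻¹' t ∈ 𝓝 (w, w) :=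
    hc.preimage_mem_nhds (by simpa [S.bracket_self] using ht)
  rw [nhds_prod_eq, Filter.mem_prod_iff] at hm
  obtain ⟨t1, ht1, t2, ht2, hsub⟩ := hm
  obtain ⟨a, hat, ha⟩ := mem_closure_iff_nhds.1 (hA (hCA hw)) t1 ht1
  obtain ⟨b, hbt, hb⟩ := mem_closure_iff_nhds.1 (hB (hCB hw)) t2 ht2
  refine ⟨S.bracket a b, hsub (mk_mem_prod hat hbt), ?_⟩
  rw [mem_interior_iff_mem_nhds, ← hC]
  exact Filter.mem_of_superset
    (S.image2_nhds hε' isOpen_interior isOpen_interior ha hb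
      (hd a (interior_subset ha) b (interior_subset hb)))
    (image2_subset interior_subset interior_subset)

/-- the homeomorphism -/
def homeo {X : Type*} [MetricSpace X] (S : SmaleSpace X) : X ≃ₜ X where
  toEquiv := S.phi
  continuous_toFun := S.phi_cont
  continuous_invFun := S.phi_symm_cont

lemma pre_cl {X : Type*} [MetricSpace X] (S : SmaleSpace X) {R : Set X}
    (h : R = closure (interior R)) :
    S.phi ⁻¹' R ⊆ closure (interior (S.phi ⁻¹' R)) := by
  have := S.homeo.preimage_closure (interior R)
  rw [S.homeo.preimage_interior, ← h] at this
  exact this.subset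

lemma im_cl {X : Type*} [MetricSpace X] (S : SmaleSpace X) {R : Set X}
    (h : R = closure (interior R)) :
    S.phi '' R ⊆ closure (interior (S.phi '' R)) := by
  have := S.homeo.image_closure (interior R)
  rw [S.homeo.image_interior, ← h] at this
  exact this.subset

lemma part_one {X : Type*} [MetricSpace X]
    [CompactSpace X] (S : SmaleSpace X) (ε' ε'' : ℝ)
    (hε' : S.epsOne ε') (hε'' : S.epsTwo ε' ε'')
    (R1 : Set (Set X)) (hMP : S.IsMarkovPartition ε' R1)
    (hdR : ∀ R ∈ R1, ∀ a ∈ R, ∀ b ∈ R, dist a b ≤ ε'')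
    (hsymm : ∀ a b, dist a b ≤ ε'' → dist (S.phi.symm a) (S.phi.symm b) ≤ ε' / 2)
    (Ri : Set X) (hi : Ri ∈ R1) (Rj : Set X) (hj : Rj ∈ R1)
    (hne : (interior Ri ∩ ⇑S.phi ⁻¹' interior Rj).Nonempty)
    (x : X) (hx : S.phi x ∈ Rj) (y : X) (hy : y ∈ Ri) :
    dist x y ≤ ε' ∧ S.bracket x y ∈ Ri ∧ S.phi (S.bracket x y) ∈ Rj := by
  obtain ⟨z, hzi, hzj⟩ := hne
  obtain ⟨h0, h1, h2⟩ := hε'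
  obtain ⟨g0, g1, g2⟩ := hε''
  obtain ⟨-, -, hrect, -, hM⟩ := hMP
  obtain ⟨Mu, Ms⟩ := hM Ri hi Rj hj z hzi hzj
  have he := S.eps_pos
  have hzi' := interior_subset hzi
  have hzj' : S.phi z ∈ Rj := interior_subset hzj
  have bi := (hrect Ri hi).1.2.2
  have bj := (hrect Rj hj).1.2.2
  have dxz : dist x z ≤ ε' / 2 := by
    simpa using hsymm _ _ (hdR Rj hj _ hx _ hzj')
  have dzy := hdR Ri hi _ hzi' _ hy
  have dxy : dist x y ≤ ε' := by linarith [dist_triangle x z y]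
  have dpp := hdR Rj hj _ hx _ hzj'
  have ephi : S.phi (S.bracket x z) = S.bracket (S.phi x) (S.phi z) :=
    S.bracket_phi _ _ (by linarith) (by linarith)
  have huj : S.bracket (S.phi x) (S.phi z) ∈ Rj := bj _ hx _ hzj'
  have hui : S.bracket x z ∈ Ri := by
    have : S.bracket (S.phi x) (S.phi z) ∈ S.unstableIn ε' (S.phi z) Rj := by
      refine ⟨⟨?_, ?_⟩, huj⟩
      · linarith [hdR Rj hj _ hzj' _ huj]
      · exact S.bracket_assoc₂ _ _ _ (by linarith)
          (by linarith [hdR Rj hj _ huj _ hzj']) (by linarith)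
    obtain ⟨u, hu, hue⟩ := Mu this
    rw [← ephi] at hue
    rw [← S.phi.injective hue]
    exact hu.2
  have hvi : S.bracket z y ∈ Ri := bi _ hzi' _ hy
  have dzv := hdR Ri hi _ hzi' _ hvi
  have hvj : S.phi (S.bracket z y) ∈ Rj := by
    refine (Ms ⟨_, ⟨⟨by linarith, ?_⟩, hvi⟩, rfl⟩).2
    exact S.bracket_assoc₁ _ _ _ (by linarith) (by linarith) (by linarith)
  have duv := hdR Ri hi _ hui _ hvi
  have key : S.bracket (S.bracket x z) (S.bracket z y) = S.bracket x y := by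
    have : dist x (S.bracket z y) ≤ S.eps := by
      linarith [dist_triangle x z (S.bracket z y)]
    rw [S.bracket_assoc₂ _ _ _ (by linarith) (by linarith) this,
      S.bracket_assoc₁ _ _ _ (by linarith) this (by linarith)]
  rw [← key]
  refine ⟨dxy, bi _ hui _ hvi, ?_⟩
  rw [S.bracket_phi _ _ (by linarith)]
  · exact bj _ (ephi ▸ huj) _ hvj
  · linarith [hdR Rj hj _ (ephi ▸ huj : S.phi (S.bracket x z) ∈ Rj) _ hvj]

end SmaleSpace

/-- The Markov property of a Markov partition: bracketing descriptions of the
intersections `R_i ∩ φ^{-1}(R_j)` and `φ(R_i) ∩ R_j ∩ φ^{-1}(R_k)`. -/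
theorem markov_partition_bracket_property {X : Type*} [MetricSpace X]
    [CompactSpace X] (S : SmaleSpace X) (ε' ε'' : ℝ)
    (hε' : S.epsOne ε') (hε'' : S.epsTwo ε' ε'')
    (R1 : Set (Set X)) (hMP : S.IsMarkovPartition ε' R1)
    (hdiam : ∀ R ∈ R1, diam R ≤ ε'') :
    (∀ Ri ∈ R1, ∀ Rj ∈ R1,
      (interior Ri ∩ ⇑S.phi ⁻¹' interior Rj).Nonempty →
      Set.image2 S.bracket (⇑S.phi ⁻¹' Rj) Ri = Ri ∩ ⇑S.phi ⁻¹' Rj ∧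
      S.IsProperRectangle ε' (Ri ∩ ⇑S.phi ⁻¹' Rj)) ∧
    (∀ Ri ∈ R1, ∀ Rj ∈ R1, ∀ Rk ∈ R1,
      (⇑S.phi '' interior Ri ∩ interior Rj ∩ ⇑S.phi ⁻¹' interior Rk).Nonempty →
      Set.image2 S.bracket (⇑S.phi ⁻¹' Rk) (⇑S.phi '' Ri) =
        ⇑S.phi '' Ri ∩ Rj ∩ ⇑S.phi ⁻¹' Rk ∧
      S.IsProperRectangle ε' (⇑S.phi '' Ri ∩ Rj ∩ ⇑S.phi ⁻¹' Rk) ∧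
      ⇑S.phi '' Ri ∩ Rj ∩ ⇑S.phi ⁻¹' Rk = ⇑S.phi '' Ri ∩ ⇑S.phi ⁻¹' Rk) := by
  have hdR : ∀ R ∈ R1, ∀ a ∈ R, ∀ b ∈ R, dist a b ≤ ε'' := fun R hR a ha b hb =>
    (dist_le_diam_of_mem (Metric.isBounded_of_compactSpace) ha hb).trans (hdiam R hR)
  have hsymm : ∀ a b, dist a b ≤ ε'' → dist (S.phi.symm a) (S.phi.symm b) ≤ ε' / 2 :=
    fun a b h => by simpa using (hε''.2.2 a b h).1 (-1) (by norm_num)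
  have hfwd : ∀ a b, dist a b ≤ ε'' → dist (S.phi a) (S.phi b) ≤ ε' / 2 :=
    fun a b h => by simpa using (hε''.2.2 a b h).1 1 (by norm_num)
  have P1 := S.part_one ε' ε'' hε' hε'' R1 hMP hdR hsymm
  have hrect := hMP.2.2.1
  have h0 := hε'.1
  have h1 := hε'.2.1
  have g0 := hε''.1
  have g1 := hε''.2.1
  constructor
  · intro Ri hi Rj hj hne
    have P := P1 Ri hi Rj hj hne
    have heq : Set.image2 S.bracket (⇑S.phi ⁻¹' Rj) Ri = Ri ∩ ⇑S.phi ⁻¹' Rj := by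
      apply Subset.antisymm
      · rintro _ ⟨x, hx, y, hy, rfl⟩
        exact (P x hx y hy).2
      · intro w hw
        exact ⟨w, hw.2, w, hw.1, S.bracket_self w⟩
    have hcl : IsClosed (Ri ∩ ⇑S.phi ⁻¹' Rj) :=
      (hrect Ri hi).2.1.inter ((hrect Rj hj).2.1.preimage S.phi_cont)
    refine ⟨heq, ⟨hne.mono (inter_subset_inter interior_subset
      (preimage_mono interior_subset)), ?_, ?_⟩, hcl, ?_⟩
    · exact (diam_mono inter_subset_left Metric.isBounded_of_compactSpace).trans
        ((hdiam Ri hi).trans (by linarith))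
    · intro x hx y hy
      exact (P x hx.2 y hy.1).2
    · apply Subset.antisymm _ (closure_minimal interior_subset hcl)
      exact S.subset_closure_interior hε' (S.pre_cl (hrect Rj hj).2.2)
        (hrect Ri hi).2.2.subset (fun a ha b hb => (P a ha b hb).1) heq
        inter_subset_right inter_subset_left
  · intro Ri hi Rj hj Rk hk hne
    obtain ⟨z, ⟨⟨z', hz'i, hz'z⟩, hzj⟩, hzk⟩ := hne
    have Pij := P1 Ri hi Rj hj ⟨z', hz'i, by rw [mem_preimage, hz'z]; exact hzj⟩
    have Pjk := P1 Rj hj Rk hk ⟨z, hzj, hzk⟩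
    have hz'i' := interior_subset hz'i
    have hzj' := interior_subset hzj
    have hzk' : S.phi z ∈ Rk := interior_subset hzk
    have P : ∀ x, S.phi x ∈ Rk → ∀ y ∈ Ri, dist x (S.phi y) ≤ ε' ∧
        S.bracket x (S.phi y) ∈ S.phi '' Ri ∩ Rj ∩ ⇑S.phi ⁻¹' Rk := by
      intro x hx y hy
      have dxz : dist x z ≤ ε' / 2 := by
        simpa using hsymm _ _ (hdR Rk hk _ hx _ hzk')
      have dzy' := hdR Ri hi _ hz'i' _ hy
      have dzy : dist z (S.phi y) ≤ ε' / 2 := hz'z ▸ hfwd _ _ dzy'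
      have dxy : dist x (S.phi y) ≤ ε' := by linarith [dist_triangle x z (S.phi y)]
      refine ⟨dxy, ?_⟩
      obtain ⟨-, huj, huk⟩ := Pjk x hx z hzj'
      obtain ⟨-, hvi, hvj⟩ := Pij z' (hz'z ▸ hzj') y hy
      have ev : S.phi (S.bracket z' y) = S.bracket z (S.phi y) := by
        rw [S.bracket_phi _ _ (by linarith) (by rw [hz'z]; linarith), hz'z]
      have hvj' := hvj
      rw [ev] at hvj'
      have duv := hdR Rj hj _ huj _ hvj'
      have dzv := hdR Rj hj _ hzj' _ hvj'
      have key : S.bracket (S.bracket x z) (S.bracket z (S.phi y)) = S.bracket x (S.phi y) := by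
        have : dist x (S.bracket z (S.phi y)) ≤ S.eps := by
          linarith [dist_triangle x z (S.bracket z (S.phi y))]
        rw [S.bracket_assoc₂ _ _ _ (by linarith) (by linarith) this,
          S.bracket_assoc₁ _ _ _ (by linarith) this (by linarith)]
      rw [← key]
      obtain ⟨-, hwj, hwk⟩ := Pjk _ huk _ hvj'
      refine ⟨⟨?_, hwj⟩, hwk⟩
      obtain ⟨hd, hwi, -⟩ := Pij (S.phi.symm (S.bracket x z)) (by simpa using huj) _ hvi
      refine ⟨_, hwi, ?_⟩
      have hs : S.phi (S.phi.symm (S.bracket x z)) = S.bracket x z := by simp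
      rw [S.bracket_phi _ _ (by linarith) (by rw [hs, ev]; linarith), hs, ev]
    have heq : Set.image2 S.bracket (⇑S.phi ⁻¹' Rk) (⇑S.phi '' Ri) =
        ⇑S.phi '' Ri ∩ Rj ∩ ⇑S.phi ⁻¹' Rk := by
      apply Subset.antisymm
      · rintro _ ⟨x, hx, _, ⟨y, hy, rfl⟩, rfl⟩
        exact (P x hx y hy).2
      · intro w hw
        exact ⟨w, hw.2, w, hw.1.1, S.bracket_self w⟩
    have hcl : IsClosed (⇑S.phi '' Ri ∩ Rj ∩ ⇑S.phi ⁻¹' Rk) :=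
      ((S.homeo.isClosed_image.2 (hrect Ri hi).2.1).inter (hrect Rj hj).2.1).inter
        ((hrect Rk hk).2.1.preimage S.phi_cont)
    refine ⟨heq, ⟨⟨⟨z, ⟨⟨z', hz'i', hz'z⟩, hzj'⟩, hzk'⟩, ?_, ?_⟩, hcl, ?_⟩, ?_⟩
    · exact (diam_mono (fun w hw => hw.1.2) Metric.isBounded_of_compactSpace).trans
        ((hdiam Rj hj).trans (by linarith))
    · rintro x hx _ ⟨⟨⟨y, hy, rfl⟩, -⟩, -⟩
      exact (P x hx.2 y hy).2
    · apply Subset.antisymm _ (closure_minimal interior_subset hcl)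
      refine S.subset_closure_interior hε' (S.pre_cl (hrect Rk hk).2.2)
        (S.im_cl (hrect Ri hi).2.2) ?_ heq inter_subset_right (fun w hw => hw.1.1)
      rintro a ha _ ⟨y, hy, rfl⟩
      exact (P a ha y hy).1
    · refine Subset.antisymm (inter_subset_inter_left _ inter_subset_left) ?_
      intro w hw
      rw [← heq]
      exact ⟨w, hw.2, w, hw.1, S.bracket_self w⟩
end

section
/- Let (X,d,φ) be an irreducible Smale space and ℛ₁ a Markov partition of X with diam(R) ≤ ε''_X for every R ∈ ℛ₁. Then for every n ≥ 1 the cover ℛ_n = {R : R = ⋂_{i=1-n}^{n-1} φ^{-i}(R_{x_i}) with each R_{x_i} ∈ ℛ₁ and int(R) ≠ ∅} is itself a Markov partition of X. -/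
open Set Metric MeasureTheory Topology
open scoped ENNReal NNReal

open Set Metric Topology
open scoped ENNReal

namespace SmaleSpace

section Helpers

variable {X : Type*} [MetricSpace X] (S : SmaleSpace X)

theorem zstep (i : ℤ) (x : X) : (S.phi ^ (i + 1)) x = S.phi ((S.phi ^ i) x) := by
  rw [add_comm, zpow_one_add]; rfl

theorem zcont (i : ℤ) : Continuous ⇑(S.phi ^ i) := by
  induction i using Int.induction_on with
  | zero => simpa using continuous_id
  | succ i ih =>
    have : ⇑(S.phi ^ ((i : ℤ) + 1)) = S.phi ∘ (S.phi ^ (i : ℤ)) := by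
      ext x; exact S.zstep _ x
    rw [this]; exact S.phi_cont.comp ih
  | pred i ih =>
    have : ⇑(S.phi ^ (-(i : ℤ) - 1)) = S.phi.symm ∘ (S.phi ^ (-(i : ℤ))) := by
      ext x
      have h := S.zstep (-(i : ℤ) - 1) x
      rw [sub_add_cancel] at h
      rw [Function.comp_apply, h, Equiv.symm_apply_apply]
    rw [this]; exact S.phi_symm_cont.comp ih

theorem zneg (i : ℤ) (x : X) : (S.phi ^ (-i)) ((S.phi ^ i) x) = x := by
  rw [← Equiv.Perm.mul_apply, ← zpow_add]; simp

theorem zneg' (i : ℤ) (x : X) : (S.phi ^ i) ((S.phi ^ (-i)) x) = x := by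
  rw [← Equiv.Perm.mul_apply, ← zpow_add]; simp

def zhomeo (i : ℤ) : X ≃ₜ X where
  toEquiv := S.phi ^ i
  continuous_toFun := S.zcont i
  continuous_invFun := by
    have : (S.phi ^ i).symm = S.phi ^ (-i) := by rw [zpow_neg]; rfl
    have h := S.zcont (-i)
    rw [← this] at h
    exact h

theorem zpow_bracket (n : ℤ) (hn : 0 ≤ n) (x y : X)
    (h : ∀ i : ℤ, -n ≤ i → i ≤ n → dist ((S.phi ^ i) x) ((S.phi ^ i) y) ≤ S.eps) :
    ∀ i : ℤ, -n ≤ i → i ≤ n →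
      (S.phi ^ i) (S.bracket x y) = S.bracket ((S.phi ^ i) x) ((S.phi ^ i) y) := by
  intro i
  induction i using Int.induction_on with
  | zero => intros; simp
  | succ i ih =>
    intro h1 h2
    have e := h i (by omega) (by omega)
    have e' := h (i + 1) (by omega) (by omega)
    rw [zstep, zstep] at e'
    rw [zstep, zstep, zstep, ih (by omega) (by omega), S.bracket_phi _ _ e e']
  | pred i ih =>
    intro h1 h2
    have e := h (-i) (by omega) (by omega)
    have e' := h (-i - 1) (by omega) (by omega)
    have k : ∀ w, (S.phi ^ (-(i : ℤ))) w = S.phi ((S.phi ^ (-(i : ℤ) - 1)) w) := by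
      intro w; rw [← zstep, sub_add_cancel]
    have ih := ih (by omega) (by omega)
    rw [k, k x, k y] at ih
    rw [k, k y] at e
    apply S.phi.injective
    rw [ih, S.bracket_phi _ _ e' e]

/-- small set closed under the bracket -/
def Sm (δ : ℝ) (g : Set X) : Prop :=
  (∀ x ∈ g, ∀ y ∈ g, dist x y ≤ δ) ∧ ∀ x ∈ g, ∀ y ∈ g, S.bracket x y ∈ g

variable {S}
variable {δ : ℝ} (hδ : 0 < δ) (hδe : 2 * δ ≤ S.eps)

include hδ hδe

theorem Sm.rr {g : Set X} (hg : S.Sm δ g) {x y z : X} (hx : x ∈ g) (hy : y ∈ g) (hz : z ∈ g) :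
    S.bracket x (S.bracket y z) = S.bracket x z := by
  apply S.bracket_assoc₁
  · linarith [hg.1 _ hy _ hz]
  · linarith [hg.1 _ hx _ (hg.2 _ hy _ hz)]
  · linarith [hg.1 _ hx _ hz]

theorem Sm.ll {g : Set X} (hg : S.Sm δ g) {x y z : X} (hx : x ∈ g) (hy : y ∈ g) (hz : z ∈ g) :
    S.bracket (S.bracket x y) z = S.bracket x z := by
  apply S.bracket_assoc₂
  · linarith [hg.1 _ hx _ hy]
  · linarith [hg.1 _ (hg.2 _ hx _ hy) _ hz]
  · linarith [hg.1 _ hx _ hz]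

omit hδ hδe in
theorem near_dist {c q : X} {a b : ℝ} (h : dist c q ≤ a) (hab : a < b) :
    ∀ᶠ w in 𝓝 c, dist w q ≤ b := by
  have : Filter.Tendsto (fun w : X => dist w q) (𝓝 c) (𝓝 (dist c q)) :=
    (continuous_id.dist continuous_const).continuousAt
  exact (this.eventually (gt_mem_nhds (lt_of_le_of_lt h hab))).mono fun _ h => le_of_lt h

theorem cont_left {c p : X} (h : dist c p ≤ δ) :
    Filter.Tendsto (fun w => S.bracket w p) (𝓝 c) (𝓝 (S.bracket c p)) := by
  have h1 := S.bracket_cont (c, p) (by simp only [mem_ofPred_eq]; linarith)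
  refine h1.tendsto.comp (f := fun w : X => (w, p)) ?_
  refine tendsto_nhdsWithin_iff.2 ⟨?_, ?_⟩
  · exact (by fun_prop : Continuous fun w : X => (w, p)).continuousAt
  · exact near_dist h (by linarith)

theorem cont_right {c p : X} (h : dist c p ≤ δ) :
    Filter.Tendsto (fun w => S.bracket p w) (𝓝 c) (𝓝 (S.bracket p c)) := by
  have h1 := S.bracket_cont (p, c) (by simp only [mem_ofPred_eq]; rw [dist_comm]; linarith)
  refine h1.tendsto.comp (f := fun w : X => (p, w)) ?_
  refine tendsto_nhdsWithin_iff.2 ⟨?_, ?_⟩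
  · exact (by fun_prop : Continuous fun w : X => (p, w)).continuousAt
  · refine (near_dist (b := S.eps) h (by linarith)).mono fun w hw => ?_
    simp only [mem_ofPred_eq]; rw [dist_comm]; exact hw

theorem Sm.crit {g : Set X} (hg : S.Sm δ g) {c p q : X} (hc : c ∈ g) (hp : p ∈ g) (hq : q ∈ g)
    (h1 : ∀ᶠ w in 𝓝 c, S.bracket w p ∈ g) (h2 : ∀ᶠ w in 𝓝 c, S.bracket q w ∈ g) :
    c ∈ interior g := by
  rw [mem_interior_iff_mem_nhds]
  have d1 := near_dist (hg.1 _ hc _ hp) (by linarith : δ < 2 * δ)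
  have d2 := near_dist (hg.1 _ hc _ hq) (by linarith : δ < 2 * δ)
  have d3 : ∀ᶠ w in 𝓝 c, dist w c < δ := Metric.ball_mem_nhds c hδ
  filter_upwards [h1, h2, d1, d2, d3] with w h1 h2 d1 d2 d3
  have e : dist w (S.bracket q w) ≤ S.eps := by
    linarith [dist_triangle w c (S.bracket q w), hg.1 _ hc _ h2]
  have key : S.bracket (S.bracket w p) (S.bracket q w) = w := by
    rw [S.bracket_assoc₂ w p _ (by linarith) (by linarith [hg.1 _ h1 _ h2]) e,
      S.bracket_assoc₁ w q w (by rw [dist_comm]; linarith) e (by simp; linarith),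
      S.bracket_self]
  rw [← key]
  exact hg.2 _ h1 _ h2

theorem Sm.int_bracket {g : Set X} (hg : S.Sm δ g) {p q : X} (hp : p ∈ interior g)
    (hq : q ∈ interior g) : S.bracket p q ∈ interior g := by
  have hp' := interior_subset hp
  have hq' := interior_subset hq
  have hc := hg.2 _ hp' _ hq'
  refine hg.crit hδ hδe hc hp' hq' ?_ ?_
  · have h := cont_left hδ hδe (hg.1 _ hc _ hp')
    rw [hg.ll hδ hδe hp' hq' hp', S.bracket_self] at h
    exact h.eventually (mem_interior_iff_mem_nhds.1 hp)
  · have h := cont_right hδ hδe (hg.1 _ hc _ hq')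
    rw [hg.rr hδ hδe hq' hp' hq', S.bracket_self] at h
    exact h.eventually (mem_interior_iff_mem_nhds.1 hq)

variable {ε' : ℝ} (hδε : δ < 2 * ε')

include hδε

omit hδ in
theorem lemU_mem {A B : Set X} (hA : S.Sm δ A) (hB : S.Sm δ B) {z w : X} (hz : z ∈ A)
    (hz' : S.phi z ∈ B)
    (hM : S.unstableIn ε' (S.phi z) B ⊆ S.phi '' (S.unstableIn ε' z A))
    (hw : S.phi w ∈ B) (hwz : S.bracket (S.phi w) (S.phi z) = S.phi w) :
    w ∈ A ∧ S.bracket w z = w := by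
  have h : S.phi w ∈ S.unstableIn ε' (S.phi z) B :=
    ⟨⟨lt_of_le_of_lt (hB.1 _ hz' _ hw) hδε, hwz⟩, hw⟩
  obtain ⟨y, hy, e⟩ := hM h
  have e := S.phi.injective e
  subst e
  exact ⟨hy.2, hy.1.2⟩

omit hδ in
theorem lemS_mem {A B : Set X} (hA : S.Sm δ A) (hB : S.Sm δ B) {z w : X} (hz : z ∈ A)
    (hz' : S.phi z ∈ B)
    (hM : S.phi '' (S.stableIn ε' z A) ⊆ S.stableIn ε' (S.phi z) B)
    (hw : w ∈ A) (hwz : S.bracket z w = w) :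
    S.phi w ∈ B ∧ S.bracket (S.phi z) (S.phi w) = S.phi w := by
  have h : w ∈ S.stableIn ε' z A :=
    ⟨⟨lt_of_le_of_lt (hA.1 _ hz _ hw) hδε, hwz⟩, hw⟩
  have hy := hM ⟨w, h, rfl⟩
  exact ⟨hy.2, hy.1.2⟩

theorem lemU {A B : Set X} (hA : S.Sm δ A) (hB : S.Sm δ B) {z w : X} (hz : z ∈ interior A)
    (hz' : S.phi z ∈ interior B)
    (hM : S.unstableIn ε' (S.phi z) B ⊆ S.phi '' (S.unstableIn ε' z A))
    (hw : S.phi w ∈ interior B) (hwz : S.bracket (S.phi w) (S.phi z) = S.phi w) :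
    w ∈ interior A ∧ S.bracket w z = w := by
  have iz := interior_subset hz
  have iz' := interior_subset hz'
  obtain ⟨h1, h2⟩ := lemU_mem hδe hδε hA hB iz iz' hM (interior_subset hw) hwz
  refine ⟨hA.crit hδ hδe h1 iz iz ?_ ?_, h2⟩
  · have e1 : ∀ᶠ v in 𝓝 w, S.phi v ∈ B :=
      S.phi_cont.continuousAt.eventually (mem_interior_iff_mem_nhds.1 hw)
    filter_upwards [e1, near_dist (hA.1 _ h1 _ iz) (by linarith : δ < 2 * δ)] with v e1 e2
    have hb : S.phi (S.bracket v z) = S.bracket (S.phi v) (S.phi z) :=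
      S.bracket_phi _ _ (by linarith) (by linarith [hB.1 _ e1 _ iz'])
    refine (lemU_mem hδe hδε hA hB iz iz' hM (w := S.bracket v z) ?_ ?_).1
    · rw [hb]; exact hB.2 _ e1 _ iz'
    · rw [hb]; exact hB.ll hδ hδe e1 iz' iz'
  · have h := cont_right hδ hδe (hA.1 _ h1 _ iz)
    have e : S.bracket z w = z := by
      rw [← h2, hA.rr hδ hδe iz h1 iz, S.bracket_self]
    rw [e] at h
    exact h.eventually (mem_interior_iff_mem_nhds.1 hz)

theorem lemS {A B : Set X} (hA : S.Sm δ A) (hB : S.Sm δ B) {z w : X} (hz : z ∈ interior A)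
    (hz' : S.phi z ∈ interior B)
    (hM : S.phi '' (S.stableIn ε' z A) ⊆ S.stableIn ε' (S.phi z) B)
    (hw : w ∈ interior A) (hwz : S.bracket z w = w) :
    S.phi w ∈ interior B ∧ S.bracket (S.phi z) (S.phi w) = S.phi w := by
  have iz := interior_subset hz
  have iz' := interior_subset hz'
  obtain ⟨h1, h2⟩ := lemS_mem hδe hδε hA hB iz iz' hM (interior_subset hw) hwz
  refine ⟨hB.crit hδ hδe h1 iz' iz' ?_ ?_, h2⟩
  · have h := cont_left hδ hδe (hB.1 _ h1 _ iz')
    have e : S.bracket (S.phi w) (S.phi z) = S.phi z := by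
      rw [← h2, hB.ll hδ hδe iz' h1 iz', S.bracket_self]
    rw [e] at h
    exact h.eventually (mem_interior_iff_mem_nhds.1 hz')
  · have e0 : ∀ᶠ v in 𝓝 (S.phi w), S.phi.symm v ∈ A := by
      refine S.phi_symm_cont.continuousAt.eventually (p := fun v => v ∈ A) ?_
      rw [Equiv.symm_apply_apply]
      exact mem_interior_iff_mem_nhds.1 hw
    filter_upwards [e0, near_dist (hB.1 _ h1 _ iz') (by linarith : δ < 2 * δ)] with v e1 e2
    have hb : S.phi (S.bracket z (S.phi.symm v)) = S.bracket (S.phi z) v := by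
      rw [S.bracket_phi _ _ (by linarith [hA.1 _ iz _ e1])
        (by rw [Equiv.apply_symm_apply, dist_comm]; linarith), Equiv.apply_symm_apply]
    rw [← hb]
    exact (lemS_mem hδe hδε hA hB iz iz' hM (hA.2 _ iz _ e1) (hA.rr hδ hδe iz iz e1)).1

omit hδ hδe hδε

/-- the cylinder set -/
def cyl (S : SmaleSpace X) (n : ℕ) (g : ℤ → Set X) : Set X :=
  ⋂ i ∈ Finset.Icc (-(n : ℤ)) (n : ℤ), (⇑(S.phi ^ i)) ⁻¹' (g i)

theorem mem_cyl {n : ℕ} {g : ℤ → Set X} {x : X} :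
    x ∈ S.cyl n g ↔ ∀ i : ℤ, -(n : ℤ) ≤ i → i ≤ n → (S.phi ^ i) x ∈ g i := by
  simp [cyl]

theorem mem_int_cyl {n : ℕ} {g : ℤ → Set X} {x : X} :
    x ∈ interior (S.cyl n g) ↔
      ∀ i : ℤ, -(n : ℤ) ≤ i → i ≤ n → (S.phi ^ i) x ∈ interior (g i) := by
  constructor
  · intro h i h1 h2
    have hs : S.cyl n g ⊆ (S.zhomeo i) ⁻¹' (g i) := fun y hy => mem_cyl.1 hy i h1 h2
    have := interior_mono hs h
    rw [← (S.zhomeo i).preimage_interior] at this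
    exact this
  · intro h
    rw [mem_interior_iff_mem_nhds, cyl, Filter.biInter_finset_mem]
    intro i hi
    rw [Finset.mem_Icc] at hi
    exact (S.zcont i).continuousAt.preimage_mem_nhds
      (mem_interior_iff_mem_nhds.1 (h i hi.1 hi.2))

theorem cyl_sm (hδe : 2 * δ ≤ S.eps) (hδ : 0 < δ) {n : ℕ} {g : ℤ → Set X}
    (hg : ∀ i, S.Sm δ (g i)) : S.Sm δ (S.cyl n g) := by
  constructor
  · intro x hx y hy
    have h1 := mem_cyl.1 hx 0 (by omega) (by omega)
    have h2 := mem_cyl.1 hy 0 (by omega) (by omega)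
    simpa using (hg 0).1 _ h1 _ h2
  · intro x hx y hy
    rw [mem_cyl] at *
    intro i h1 h2
    rw [S.zpow_bracket n (by omega) x y _ i h1 h2]
    · exact (hg i).2 _ (hx i h1 h2) _ (hy i h1 h2)
    · intro j h1 h2
      linarith [(hg j).1 _ (hx j h1 h2) _ (hy j h1 h2)]

theorem cyl_bracket (hδe : 2 * δ ≤ S.eps) (hδ : 0 < δ) {n : ℕ} {g : ℤ → Set X}
    (hg : ∀ i, S.Sm δ (g i)) {x y : X} (hx : x ∈ S.cyl n g) (hy : y ∈ S.cyl n g)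
    {i : ℤ} (h1 : -(n : ℤ) ≤ i) (h2 : i ≤ n) :
    (S.phi ^ i) (S.bracket x y) = S.bracket ((S.phi ^ i) x) ((S.phi ^ i) y) := by
  rw [mem_cyl] at *
  refine S.zpow_bracket n (by omega) x y ?_ i h1 h2
  intro j h1 h2
  linarith [(hg j).1 _ (hx j h1 h2) _ (hy j h1 h2)]

/-- the Markov condition on a family -/
def Mk (S : SmaleSpace X) (ε' : ℝ) (P : Set (Set X)) : Prop :=
  ∀ R ∈ P, ∀ R' ∈ P, ∀ x : X, x ∈ interior R → S.phi x ∈ interior R' →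
    S.unstableIn ε' (S.phi x) R' ⊆ S.phi '' (S.unstableIn ε' x R) ∧
    S.phi '' (S.stableIn ε' x R) ⊆ S.stableIn ε' (S.phi x) R'

include hδ hδe hδε

theorem iterU {P : Set (Set X)} (hP : ∀ R ∈ P, S.Sm δ R) (hM : S.Mk ε' P) {n : ℕ}
    {g : ℤ → Set X} (hg : ∀ i, g i ∈ P) {z y : X} (hz : z ∈ interior (S.cyl n g))
    (hy : (S.phi ^ (n : ℤ)) y ∈ interior (g n))
    (hyz : S.bracket ((S.phi ^ (n : ℤ)) y) ((S.phi ^ (n : ℤ)) z) = (S.phi ^ (n : ℤ)) y) :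
    y ∈ interior (S.cyl n g) := by
  rw [mem_int_cyl] at *
  have main : ∀ k : ℕ, k ≤ 2 * n → (S.phi ^ ((n : ℤ) - k)) y ∈ interior (g (n - k)) ∧
      S.bracket ((S.phi ^ ((n : ℤ) - k)) y) ((S.phi ^ ((n : ℤ) - k)) z)
        = (S.phi ^ ((n : ℤ) - k)) y := by
    intro k
    induction k with
    | zero => intro _; simpa using ⟨hy, hyz⟩
    | succ k ih =>
      intro hk
      obtain ⟨i1, i2⟩ := ih (by omega)
      have hz1 := hz (n - (k + 1 : ℕ)) (by omega) (by omega)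
      have hz2 := hz (n - k) (by omega) (by omega)
      have e : (n : ℤ) - k = (n - (k + 1 : ℕ)) + 1 := by push_cast; ring
      rw [e, zstep] at i1 i2 hz2
      rw [zstep] at i2
      exact lemU hδ hδe hδε (hP _ (hg _)) (hP _ (hg _)) hz1 hz2
        (hM _ (hg _) _ (hg _) _ hz1 hz2).1 i1 i2
  intro i h1 h2
  have := (main (n - i).toNat (by omega)).1
  have e : (n : ℤ) - ((n - i).toNat : ℤ) = i := by omega
  rwa [e] at this

theorem iterS {P : Set (Set X)} (hP : ∀ R ∈ P, S.Sm δ R) (hM : S.Mk ε' P) {n : ℕ}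
    {g : ℤ → Set X} (hg : ∀ i, g i ∈ P) {z y : X} (hz : z ∈ interior (S.cyl n g))
    (hy : (S.phi ^ (-(n : ℤ))) y ∈ interior (g (-n)))
    (hyz : S.bracket ((S.phi ^ (-(n : ℤ))) z) ((S.phi ^ (-(n : ℤ))) y)
      = (S.phi ^ (-(n : ℤ))) y) :
    y ∈ interior (S.cyl n g) := by
  rw [mem_int_cyl] at *
  have main : ∀ k : ℕ, k ≤ 2 * n → (S.phi ^ (-(n : ℤ) + k)) y ∈ interior (g (-n + k)) ∧
      S.bracket ((S.phi ^ (-(n : ℤ) + k)) z) ((S.phi ^ (-(n : ℤ) + k)) y)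
        = (S.phi ^ (-(n : ℤ) + k)) y := by
    intro k
    induction k with
    | zero => intro _; rw [Nat.cast_zero, add_zero]; exact ⟨hy, hyz⟩
    | succ k ih =>
      intro hk
      obtain ⟨i1, i2⟩ := ih (by omega)
      have hz1 := hz (-n + k) (by omega) (by omega)
      have hz2 := hz (-n + (k + 1 : ℕ)) (by omega) (by omega)
      have e : -(n : ℤ) + (k + 1 : ℕ) = (-n + k) + 1 := by push_cast; ring
      rw [e, zstep] at hz2
      rw [e, zstep, zstep]
      exact lemS hδ hδe hδε (hP _ (hg _)) (hP _ (hg _)) hz1 hz2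
        (hM _ (hg _) _ (hg _) _ hz1 hz2).2 i1 i2
  intro i h1 h2
  have := (main (i + n).toNat (by omega)).1
  have e : -(n : ℤ) + ((i + n).toNat : ℤ) = i := by omega
  rwa [e] at this

theorem cyl_closure {P : Set (Set X)} (hP : ∀ R ∈ P, S.Sm δ R) (hM : S.Mk ε' P)
    (hcl : ∀ R ∈ P, R = closure (interior R)) {n : ℕ}
    {g : ℤ → Set X} (hg : ∀ i, g i ∈ P) {z x : X} (hz : z ∈ interior (S.cyl n g))
    (hx : x ∈ S.cyl n g) : x ∈ closure (interior (S.cyl n g)) := by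
  have hgs : ∀ i, S.Sm δ (g i) := fun i => hP _ (hg i)
  have hsm : S.Sm δ (S.cyl n g) := cyl_sm hδe hδ hgs
  have hz0 := interior_subset hz
  have hzn := mem_int_cyl.1 hz n (by omega) (by omega)
  have hzm := mem_int_cyl.1 hz (-n) (by omega) (by omega)
  have hxn := mem_cyl.1 hx n (by omega) (by omega)
  have hxm := mem_cyl.1 hx (-n) (by omega) (by omega)
  have izn := interior_subset hzn
  have izm := interior_subset hzm
  let a : X × X → X := fun p => (S.phi ^ (-(n : ℤ))) (S.bracket p.1 ((S.phi ^ (n : ℤ)) z))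
  let b : X × X → X := fun p => (S.phi ^ (n : ℤ)) (S.bracket ((S.phi ^ (-(n : ℤ))) z) p.2)
  let s : Set (X × X) := interior (g n) ×ˢ interior (g (-n))
  let p₀ : X × X := ((S.phi ^ (n : ℤ)) x, (S.phi ^ (-(n : ℤ))) x)
  have ha : ∀ p ∈ s, a p ∈ interior (S.cyl n g) := by
    intro p hp
    refine iterU hδ hδe hδε hP hM hg hz ?_ ?_
    · simp only [a, zneg']
      exact (hgs n).int_bracket hδ hδe hp.1 hzn
    · simp only [a, zneg']
      exact (hgs n).ll hδ hδe (interior_subset hp.1) izn izn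
  have hb : ∀ p ∈ s, b p ∈ interior (S.cyl n g) := by
    intro p hp
    refine iterS hδ hδe hδε hP hM hg hz ?_ ?_
    · simp only [b, zneg]
      exact (hgs (-n)).int_bracket hδ hδe hzm hp.2
    · simp only [b, zneg]
      exact (hgs (-n)).rr hδ hδe izm izm (interior_subset hp.2)
  have ha0 : a p₀ = S.bracket x z := by
    simp only [a, p₀]
    rw [← cyl_bracket hδe hδ hgs hx hz0 (by omega) (by omega), zneg]
  have hb0 : b p₀ = S.bracket z x := by
    simp only [b, p₀]
    rw [← cyl_bracket hδe hδ hgs hz0 hx (by omega) (by omega), zneg']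
  have hp0 : p₀ ∈ closure s := by
    rw [closure_prod_eq, ← hcl _ (hg _), ← hcl _ (hg _)]
    exact ⟨hxn, hxm⟩
  have cta : ContinuousAt a p₀ := by
    have h1 := cont_left hδ hδe ((hgs n).1 _ hxn _ izn)
    have h2 : Filter.Tendsto (fun p : X × X => p.1) (𝓝 p₀) (𝓝 p₀.1) := continuous_fst.continuousAt
    exact (S.zcont _).continuousAt.tendsto.comp (h1.comp h2)
  have ctb : ContinuousAt b p₀ := by
    have h1 := cont_right hδ hδe ((hgs (-n)).1 _ hxm _ izm)
    have h2 : Filter.Tendsto (fun p : X × X => p.2) (𝓝 p₀) (𝓝 p₀.2) := continuous_snd.continuousAt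
    exact (S.zcont _).continuousAt.tendsto.comp (h1.comp h2)
  have d0 : dist (a p₀) (b p₀) ≤ S.eps := by
    rw [ha0, hb0]
    linarith [hsm.1 _ (hsm.2 _ hx _ hz0) _ (hsm.2 _ hz0 _ hx)]
  have ctF : ContinuousWithinAt (fun p => S.bracket (a p) (b p)) s p₀ := by
    have h1 := S.bracket_cont (a p₀, b p₀) d0
    refine ContinuousWithinAt.comp (g := fun p : X × X => S.bracket p.1 p.2)
      (f := fun p => (a p, b p)) (t := {p : X × X | dist p.1 p.2 ≤ S.eps}) h1
      (cta.continuousWithinAt.prodMk ctb.continuousWithinAt) ?_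
    intro p hp
    have := hsm.1 _ (interior_subset (ha p hp)) _ (interior_subset (hb p hp))
    simp only [mem_ofPred_eq]
    linarith
  have hF := ctF.mem_closure hp0 (t := interior (S.cyl n g))
    (fun p hp => hsm.int_bracket hδ hδe (ha p hp) (hb p hp))
  have e : S.bracket (a p₀) (b p₀) = x := by
    rw [ha0, hb0, hsm.ll hδ hδe hx hz0 (hsm.2 _ hz0 _ hx), hsm.rr hδ hδe hx hz0 hx,
      S.bracket_self]
  rwa [e] at hF

theorem cyl_markov {P : Set (Set X)} (hP : ∀ R ∈ P, S.Sm δ R) (hM : S.Mk ε' P)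
    (hdis : ∀ R ∈ P, ∀ R' ∈ P, R ≠ R' → interior R ∩ interior R' = ∅) {n : ℕ}
    {g g' : ℤ → Set X} (hg : ∀ i, g i ∈ P) (hg' : ∀ i, g' i ∈ P) {x : X}
    (hx : x ∈ interior (S.cyl n g)) (hx' : S.phi x ∈ interior (S.cyl n g')) :
    S.unstableIn ε' (S.phi x) (S.cyl n g') ⊆ S.phi '' (S.unstableIn ε' x (S.cyl n g)) ∧
    S.phi '' (S.stableIn ε' x (S.cyl n g)) ⊆ S.stableIn ε' (S.phi x) (S.cyl n g') := by
  have hgs : ∀ i, S.Sm δ (g i) := fun i => hP _ (hg i)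
  have hgs' : ∀ i, S.Sm δ (g' i) := fun i => hP _ (hg' i)
  have hsm : S.Sm δ (S.cyl n g) := cyl_sm hδe hδ hgs
  have hsm' : S.Sm δ (S.cyl n g') := cyl_sm hδe hδ hgs'
  have hxm := interior_subset hx
  have hxm' := interior_subset hx'
  have zc : ∀ (i : ℤ) (y : X), (S.phi ^ i) (S.phi y) = S.phi ((S.phi ^ i) y) := by
    intro i y
    rw [← zstep, zpow_add_one]; rfl
  have heq : ∀ i : ℤ, -(n : ℤ) ≤ i → i + 1 ≤ n → g' i = g (i + 1) := by
    intro i h1 h2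
    by_contra hne
    have k1 := mem_int_cyl.1 hx' i h1 (by omega)
    have k2 := mem_int_cyl.1 hx (i + 1) (by omega) h2
    rw [zstep] at k2
    rw [zc] at k1
    have := hdis _ (hg' _) _ (hg _) hne
    exact (Set.eq_empty_iff_forall_notMem.1 this _) ⟨k1, k2⟩
  constructor
  · rintro y ⟨⟨_, hy2⟩, hy⟩
    obtain ⟨w, rfl⟩ := S.phi.surjective y
    have hw : w ∈ S.cyl n g := by
      rw [mem_cyl]
      intro i h1 h2
      rcases eq_or_lt_of_le h1 with rfl | h1
      · have z1 := mem_int_cyl.1 hx (-n) (by omega) (by omega)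
        have z2 := mem_int_cyl.1 hx' (-n) (by omega) (by omega)
        have y2 := mem_cyl.1 hy (-n) (by omega) (by omega)
        have br := cyl_bracket hδe hδ hgs' hy hxm' (i := -n) (by omega) (by omega)
        rw [hy2] at br
        rw [zc] at z2 y2
        rw [zc, zc] at br
        exact (lemU_mem hδe hδε (hgs _) (hgs' _) (interior_subset z1) (interior_subset z2)
          (hM _ (hg _) _ (hg' _) _ z1 z2).1 y2 br.symm).1
      · have y2 := mem_cyl.1 hy (i - 1) (by omega) (by omega)
        rw [heq (i - 1) (by omega) (by omega), zc, ← zstep, sub_add_cancel] at y2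
        exact y2
    refine ⟨w, ⟨⟨lt_of_le_of_lt (hsm.1 _ hxm _ hw) hδε, ?_⟩, hw⟩, rfl⟩
    apply S.phi.injective
    rw [S.bracket_phi _ _ (by linarith [hsm.1 _ hw _ hxm]) (by linarith [hsm'.1 _ hy _ hxm'])]
    exact hy2
  · rintro _ ⟨w, ⟨⟨_, hw2⟩, hw⟩, rfl⟩
    have hy : S.phi w ∈ S.cyl n g' := by
      rw [mem_cyl]
      intro i h1 h2
      rcases eq_or_lt_of_le h2 with rfl | h2
      · have z1 := mem_int_cyl.1 hx n (by omega) (by omega)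
        have z2 := mem_int_cyl.1 hx' n (by omega) (by omega)
        have y1 := mem_cyl.1 hw n (by omega) (by omega)
        have br := cyl_bracket hδe hδ hgs hxm hw (i := n) (by omega) (by omega)
        rw [hw2] at br
        rw [zc] at z2 ⊢
        exact (lemS_mem hδe hδε (hgs _) (hgs' _) (interior_subset z1) (interior_subset z2)
          (hM _ (hg _) _ (hg' _) _ z1 z2).2 y1 br.symm).1
      · have y2 := mem_cyl.1 hw (i + 1) (by omega) (by omega)
        rw [← heq i (by omega) (by omega), zstep, ← zc] at y2
        exact y2
    refine ⟨⟨lt_of_le_of_lt (hsm'.1 _ hxm' _ hy) hδε, ?_⟩, hy⟩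
    rw [← S.bracket_phi _ _ (by linarith [hsm.1 _ hxm _ hw]) (by linarith [hsm'.1 _ hxm' _ hy]),
      hw2]

end Helpers

theorem markovSeq_finite {X : Type*} [MetricSpace X] (S : SmaleSpace X) (P : Set (Set X))
    (hP : P.Finite) (n : ℕ) : (S.markovSeq P (n + 1)).Finite := by
  classical
  have : Finite P := hP
  let I := Finset.Icc (-(n : ℤ)) (n : ℤ)
  let F : (I → P) → Set X := fun f => ⋂ i : I, (⇑(S.phi ^ (i : ℤ))) ⁻¹' (f i : Set X)
  refine (Set.finite_range F).subset ?_
  rintro R ⟨_, g, hg, rfl⟩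
  refine ⟨fun i => ⟨g i, hg i⟩, ?_⟩
  ext x
  simp [F, I]

theorem markovSeq_cover {X : Type*} [MetricSpace X] (S : SmaleSpace X)
    (P : Set (Set X)) (hP : P.Finite) (hcov : ⋃₀ P = Set.univ)
    (hcl : ∀ R ∈ P, R = closure (interior R)) (n : ℕ) :
    ⋃₀ S.markovSeq P (n + 1) = Set.univ := by
  have hfin := S.markovSeq_finite P hP n
  have hclosed : IsClosed (⋃₀ S.markovSeq P (n + 1)) := by
    rw [sUnion_eq_biUnion]
    refine Set.Finite.isClosed_biUnion hfin ?_
    rintro R ⟨_, g, hg, rfl⟩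
    refine isClosed_biInter fun i _ => IsClosed.preimage (S.zcont i) ?_
    rw [hcl _ (hg i)]; exact isClosed_closure
  let D : Set X := ⋃ R ∈ P, interior R
  have hDo : IsOpen D := isOpen_biUnion fun _ _ => isOpen_interior
  have hDd : Dense D := by
    intro x
    have hx : x ∈ ⋃₀ P := hcov ▸ mem_univ x
    obtain ⟨R, hR, hxR⟩ := hx
    rw [hcl R hR] at hxR
    exact closure_mono (subset_biUnion_of_mem (u := fun R => interior R) hR) hxR
  have hE : Dense (⋂ i ∈ Finset.Icc (-(n : ℤ)) (n : ℤ), (⇑(S.phi ^ i)) ⁻¹' D) := by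
    have key : ∀ s : Finset ℤ, Dense (⋂ i ∈ s, (⇑(S.phi ^ i)) ⁻¹' D) ∧
        IsOpen (⋂ i ∈ s, (⇑(S.phi ^ i)) ⁻¹' D) := by
      intro s
      classical
      induction s using Finset.induction_on with
      | empty => simp
      | insert a s ha ih =>
        rw [Finset.set_biInter_insert]
        have o : IsOpen ((⇑(S.phi ^ a)) ⁻¹' D) := hDo.preimage (S.zcont a)
        have d : Dense ((⇑(S.phi ^ a)) ⁻¹' D) := hDd.preimage (S.zhomeo a).isOpenMap
        exact ⟨d.inter_of_isOpen_left ih.1 o, o.inter ih.2⟩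
    exact (key _).1
  refine eq_univ_of_univ_subset ?_
  rw [← hE.closure_eq]
  refine closure_minimal ?_ hclosed
  intro x hx
  have hne : P.Nonempty := by
    obtain ⟨R, hR, _⟩ : x ∈ ⋃₀ P := hcov ▸ mem_univ x
    exact ⟨R, hR⟩
  have : ∀ i : ℤ, ∃ R ∈ P, i ∈ Finset.Icc (-(n : ℤ)) (n : ℤ) → (S.phi ^ i) x ∈ interior R := by
    intro i
    by_cases hi : i ∈ Finset.Icc (-(n : ℤ)) (n : ℤ)
    · have := mem_iInter₂.1 hx i hi
      simp only [D, mem_preimage, mem_iUnion] at this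
      obtain ⟨R, hR, h⟩ := this
      exact ⟨R, hR, fun _ => h⟩
    · obtain ⟨R, hR⟩ := hne
      exact ⟨R, hR, fun h => absurd h hi⟩
  choose g hg hgx using this
  have hint : x ∈ interior (S.cyl n g) :=
    mem_int_cyl.2 fun i h1 h2 => hgx i (Finset.mem_Icc.2 ⟨h1, h2⟩)
  exact ⟨S.cyl n g, ⟨⟨x, hint⟩, g, hg, rfl⟩, interior_subset hint⟩

end SmaleSpace

/-- For an irreducible Smale space with a Markov partition `ℛ₁` of sufficiently
small diameter, every cover `ℛ_n` of the induced refining sequence is itself a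
Markov partition. -/
theorem markovSeq_isMarkovPartition {X : Type*} [MetricSpace X]
    [CompactSpace X] (S : SmaleSpace X) (ε' ε'' : ℝ)
    (hε' : S.epsOne ε') (hε'' : S.epsTwo ε' ε'')
    (hirr : IrreducibleSystem ⇑S.phi)
    (R1 : Set (Set X)) (hMP : S.IsMarkovPartition ε' R1)
    (hdiam : ∀ R ∈ R1, diam R ≤ ε'') :
    ∀ n : ℕ, 1 ≤ n → S.IsMarkovPartition ε' (S.markovSeq R1 n) := by
  intro n hn
  obtain ⟨m, rfl⟩ : ∃ m, n = m + 1 := ⟨n - 1, by omega⟩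
  obtain ⟨hfin, hcov, hprop, hdis, hM⟩ := hMP
  obtain ⟨e1, e2, _⟩ := hε'
  obtain ⟨d1, d2, _⟩ := hε''
  have hδe : 2 * ε'' ≤ S.eps := by linarith
  have hδε : ε'' < 2 * ε' := by linarith
  have hP : ∀ R ∈ R1, S.Sm ε'' R := fun R hR =>
    ⟨fun x hx y hy => (Metric.dist_le_diam_of_mem (Metric.isBounded_of_compactSpace) hx hy).trans
      (hdiam R hR), (hprop R hR).1.2.2⟩
  have hcl : ∀ R ∈ R1, R = closure (interior R) := fun R hR => (hprop R hR).2.2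
  refine ⟨S.markovSeq_finite R1 hfin m, S.markovSeq_cover R1 hfin hcov hcl m, ?_, ?_, ?_⟩
  · rintro R ⟨⟨z, hz⟩, g, hg, rfl⟩
    have hz : z ∈ interior (S.cyl m g) := hz
    have hsm : S.Sm ε'' (S.cyl m g) := SmaleSpace.cyl_sm hδe d1 fun i => hP _ (hg i)
    have hclosed : IsClosed (S.cyl m g) := by
      refine isClosed_biInter fun i _ => IsClosed.preimage (S.zcont i) ?_
      rw [hcl _ (hg i)]; exact isClosed_closure
    change S.IsProperRectangle ε' (S.cyl m g)
    refine ⟨⟨⟨z, interior_subset hz⟩, ?_, hsm.2⟩, hclosed, ?_⟩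
    · exact Metric.diam_le_of_forall_dist_le e1.le fun x hx y hy =>
        (hsm.1 x hx y hy).trans (by linarith)
    · exact Subset.antisymm
        (fun x hx => SmaleSpace.cyl_closure d1 hδe hδε hP hM hcl hg hz hx)
        (closure_minimal interior_subset hclosed)
  · rintro R ⟨_, g, hg, rfl⟩ R' ⟨_, g', hg', rfl⟩ hne
    by_contra hcon
    obtain ⟨x, hx, hx'⟩ := Set.nonempty_iff_ne_empty.2 hcon
    have hx : x ∈ interior (S.cyl m g) := hx
    have hx' : x ∈ interior (S.cyl m g') := hx'
    rw [SmaleSpace.mem_int_cyl] at hx hx'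
    apply hne
    refine iInter₂_congr fun i hi => ?_
    rw [Finset.mem_Icc] at hi
    by_contra h
    have hgg : g i ≠ g' i := fun e => h (by rw [e])
    have := hdis _ (hg i) _ (hg' i) hgg
    exact (Set.eq_empty_iff_forall_notMem.1 this _) ⟨hx i hi.1 hi.2, hx' i hi.1 hi.2⟩
  · rintro R ⟨_, g, hg, rfl⟩ R' ⟨_, g', hg', rfl⟩ x hx hx'
    exact SmaleSpace.cyl_markov d1 hδe hδε hP hM hdis hg hg' hx hx'
end

section
/- Let (X,d,φ) be an irreducible Smale space and ℛ₁ a Markov partition of X with diam(R) ≤ ε''_X for every R ∈ ℛ₁, giving rise to the refining sequence (ℛ_n)_{n≥0} of Markov partitions. Then there exists N ∈ ℕ such that for every n ≥ 1 and every pair of disjoint rectangles R, S ∈ ℛ_n one has N_{ℛ_{n+N}}(R) ∩ N_{ℛ_{n+N}}(S) = ∅, where for a cover 𝒰 and a set Y, N_𝒰(Y) = {U ∈ 𝒰 : U ∩ Y ≠ ∅}; equivalently, whenever two elements of ℛ_{n+N} intersect a common element of ℛ_{n+N}, their (unique) ancestors in ℛ_n intersect. -/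
open Set Metric MeasureTheory Topology
open scoped ENNReal NNReal

open Set Metric Topology
open scoped ENNReal

namespace SmaleSpace

variable {X : Type*} [MetricSpace X] (S : SmaleSpace X)

theorem cont_zpow (i : ℤ) : Continuous (⇑(S.phi ^ i)) := by
  have hn : ∀ k : ℕ, Continuous (⇑(S.phi ^ k)) := by
    intro k
    rw [Equiv.Perm.coe_pow]
    exact S.phi_cont.iterate k
  have hn' : ∀ k : ℕ, Continuous (⇑((S.phi⁻¹) ^ k)) := by
    intro k
    rw [Equiv.Perm.coe_pow]
    exact S.phi_symm_cont.iterate k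
  obtain ⟨k, rfl | rfl⟩ := i.eq_nat_or_neg
  · simpa using hn k
  · have := hn' k
    rw [inv_pow] at this
    simpa using this

theorem zpow_mem_interior {R A : Set X} (i : ℤ) (h : R ⊆ (⇑(S.phi ^ i)) ⁻¹' A) {p : X}
    (hp : p ∈ interior R) : (S.phi ^ i) p ∈ interior A := by
  have hopen : IsOpen ((⇑(S.phi ^ (-i))) ⁻¹' interior R) :=
    isOpen_interior.preimage (S.cont_zpow (-i))
  have hsub : (⇑(S.phi ^ (-i))) ⁻¹' interior R ⊆ A := by
    intro y hy
    have := h (interior_subset hy)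
    rw [Set.mem_preimage, ← Equiv.Perm.mul_apply, ← zpow_add, add_neg_cancel, zpow_zero, Equiv.Perm.one_apply] at this
    exact this
  refine interior_maximal hsub hopen ?_
  rw [Set.mem_preimage, ← Equiv.Perm.mul_apply, ← zpow_add, neg_add_cancel, zpow_zero, Equiv.Perm.one_apply]
  exact hp

/-- Markov transition data. -/
structure Trans (ε' ε'' : ℝ) (A B : Set X) : Prop where
  rA : ∀ x ∈ A, ∀ y ∈ A, S.bracket x y ∈ A
  rB : ∀ x ∈ B, ∀ y ∈ B, S.bracket x y ∈ B
  dA : ∀ x ∈ A, ∀ y ∈ A, dist x y ≤ ε''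
  dB : ∀ x ∈ B, ∀ y ∈ B, dist x y ≤ ε''
  ex : ∃ p ∈ A, S.phi p ∈ B ∧
    S.unstableIn ε' (S.phi p) B ⊆ S.phi '' (S.unstableIn ε' p A) ∧
    S.phi '' (S.stableIn ε' p A) ⊆ S.stableIn ε' (S.phi p) B

variable {S} {ε' ε'' : ℝ}

theorem epsTwo.phi (h : S.epsTwo ε' ε'') {x y : X} (hd : dist x y ≤ ε'') :
    dist (S.phi x) (S.phi y) ≤ ε' / 2 := by
  simpa using (h.2.2 x y hd).1 1 (by norm_num)

theorem epsTwo.phi_symm (h : S.epsTwo ε' ε'') {x y : X} (hd : dist x y ≤ ε'') :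
    dist (S.phi.symm x) (S.phi.symm y) ≤ ε' / 2 := by
  have := (h.2.2 x y hd).1 (-1) (by norm_num)
  rw [zpow_neg_one] at this
  exact this

theorem Trans.fwd (h1 : S.epsOne ε') (h2 : S.epsTwo ε' ε'') {A B : Set X}
    (M : S.Trans ε' ε'' A B) {w z : X} (hw : w ∈ A) (hz : z ∈ B) :
    S.bracket z (S.phi w) ∈ B ∧
      S.bracket (S.bracket z (S.phi w)) (S.phi w) = S.bracket z (S.phi w) := by
  obtain ⟨p, hp, hpB, -, hs⟩ := M.ex
  have e1 := h1.1
  have e2 := h1.2.1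
  have e3 := h2.1
  have e4 := h2.2.1
  have hpw : dist p w ≤ ε'' := M.dA _ hp _ hw
  have hpw' := h2.phi hpw
  have hb := M.rA _ hp _ hw
  have hpb := M.dA _ hp _ hb
  have k1 : S.bracket p (S.bracket p w) = S.bracket p w :=
    S.bracket_assoc₁ _ _ _ (by linarith) (by linarith) (by linarith)
  have k2 : S.phi (S.bracket p w) ∈ B :=
    (hs ⟨_, ⟨⟨by linarith, k1⟩, hb⟩, rfl⟩).2
  rw [S.bracket_phi _ _ (by linarith) (by linarith)] at k2
  have hzp := M.dB _ hz _ hpB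
  have hzw : dist z (S.phi w) ≤ ε'' + ε' / 2 := (dist_triangle _ (S.phi p) _).trans (by linarith)
  have hzk := M.dB _ hz _ k2
  have k3 : S.bracket z (S.bracket (S.phi p) (S.phi w)) = S.bracket z (S.phi w) :=
    S.bracket_assoc₁ _ _ _ (by linarith) (by linarith) (by linarith)
  have k4 : S.bracket z (S.phi w) ∈ B := k3 ▸ M.rB _ hz _ k2
  refine ⟨k4, ?_⟩
  have hbp := M.dB _ k4 _ hpB
  have hbw : dist (S.bracket z (S.phi w)) (S.phi w) ≤ ε'' + ε' / 2 :=
    (dist_triangle _ (S.phi p) _).trans (by linarith)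
  exact S.bracket_assoc₂ _ _ _ (by linarith) (by linarith) (by linarith)

theorem Trans.back (h1 : S.epsOne ε') (h2 : S.epsTwo ε' ε'') {A B : Set X}
    (M : S.Trans ε' ε'' A B) {w v : X} (hw : w ∈ A) (hv : v ∈ B)
    (hvw : S.bracket v (S.phi w) = v) :
    S.phi.symm v ∈ A ∧ S.bracket (S.phi.symm v) w = S.phi.symm v := by
  obtain ⟨p, hp, hpB, hu, -⟩ := M.ex
  have e1 := h1.1
  have e2 := h1.2.1
  have e3 := h2.1
  have e4 := h2.2.1
  have hpw : dist p w ≤ ε'' := M.dA _ hp _ hw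
  have hpw' := h2.phi hpw
  have hvp := M.dB _ hv _ hpB
  have hvp' : dist (S.phi.symm v) p ≤ ε' / 2 := by simpa using h2.phi_symm hvp
  have hb := M.rB _ hv _ hpB
  have hbp := M.dB _ hpB _ hb
  have hbp' := M.dB _ hb _ hpB
  have k1 : S.bracket (S.bracket v (S.phi p)) (S.phi p) = S.bracket v (S.phi p) :=
    S.bracket_assoc₂ _ _ _ (by linarith) (by linarith) (by linarith)
  obtain ⟨t, ⟨-, ht⟩, htv⟩ := hu ⟨⟨by linarith, k1⟩, hb⟩
  have k2 : t = S.bracket (S.phi.symm v) p := by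
    apply S.phi.injective
    rw [htv, S.bracket_phi _ _ (by linarith) (by simp; linarith)]
    simp
  have hvw1 : dist (S.phi.symm v) w ≤ ε'' + ε' / 2 :=
    (dist_triangle _ p _).trans (by linarith)
  have hvw2 : dist v (S.phi w) ≤ ε'' + ε' / 2 :=
    (dist_triangle _ (S.phi p) _).trans (by linarith)
  have htw := M.dA _ ht _ hw
  have k3 : S.bracket t w = S.bracket (S.phi.symm v) w := by
    rw [k2] at htw ⊢
    exact S.bracket_assoc₂ _ _ _ (by linarith) (by linarith) (by linarith)
  have k4 : S.bracket (S.phi.symm v) w = S.phi.symm v := by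
    apply S.phi.injective
    rw [S.bracket_phi _ _ (by linarith) (by simp; linarith)]
    simpa using hvw
  refine ⟨?_, k4⟩
  rw [← k4, ← k3]
  exact M.rA _ ht _ hw

/-- Points whose backward orbit follows both itineraries. -/
def Good (S : SmaleSpace X) (a b : ℕ → Set X) : ℕ → X → Prop
  | 0, w => w ∈ a 0 ∩ b 0
  | (k + 1), w => w ∈ a (k + 1) ∩ b (k + 1) ∧ Good S a b k (S.phi.symm w)

theorem Good.mem {a b : ℕ → Set X} : ∀ {k : ℕ} {w : X}, S.Good a b k w → w ∈ a k ∩ b k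
  | 0, _, h => h
  | (_ + 1), _, h => h.1

theorem Good.orbit {a b : ℕ → Set X} : ∀ {k : ℕ} {w : X}, S.Good a b k w →
    ∀ j : ℕ, j ≤ k → (S.phi ^ ((j : ℤ) - k)) w ∈ a j ∩ b j := by
  intro k
  induction k with
  | zero =>
    intro w h j hj
    obtain rfl : j = 0 := by omega
    simpa using h.mem
  | succ k ih =>
    intro w h j hj
    rcases Nat.lt_or_ge j (k + 1) with hjk | hjk
    · have := ih h.2 j (by omega)
      have e : (j : ℤ) - ((k + 1 : ℕ) : ℤ) = ((j : ℤ) - k) + (-1) := by push_cast; ring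
      rw [e, zpow_add, Equiv.Perm.mul_apply, zpow_neg_one]
      exact this
    · obtain rfl : j = k + 1 := by omega
      simpa using h.mem

theorem Good.move (h1 : S.epsOne ε') (h2 : S.epsTwo ε' ε'') {a b : ℕ → Set X} {m : ℕ}
    (Ma : ∀ k < m, S.Trans ε' ε'' (a k) (a (k + 1)))
    (Mb : ∀ k < m, S.Trans ε' ε'' (b k) (b (k + 1))) :
    ∀ k ≤ m, ∀ w v : X, S.Good a b k w → v ∈ a k ∩ b k → S.bracket v w = v →
      S.Good a b k v := by
  intro k
  induction k with
  | zero => intro _ w v _ hv _; exact hv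
  | succ k ih =>
    intro hk w v hw hv hb
    have hw1 := hw.2.mem
    have hb' : S.bracket v (S.phi (S.phi.symm w)) = v := by simpa using hb
    obtain ⟨q1, q2⟩ := (Ma k (by omega)).back h1 h2 hw1.1 hv.1 hb'
    obtain ⟨q3, -⟩ := (Mb k (by omega)).back h1 h2 hw1.2 hv.2 hb'
    exact ⟨hv, ih (by omega) _ _ hw.2 ⟨q1, q3⟩ q2⟩

theorem exists_good (h1 : S.epsOne ε') (h2 : S.epsTwo ε' ε'') {a b : ℕ → Set X} {m : ℕ}
    (Ma : ∀ k < m, S.Trans ε' ε'' (a k) (a (k + 1)))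
    (Mb : ∀ k < m, S.Trans ε' ε'' (b k) (b (k + 1)))
    (hab : ∀ k ≤ m, (a k ∩ b k).Nonempty) :
    ∀ k ≤ m, ∃ w, S.Good a b k w := by
  intro k
  induction k with
  | zero => intro h; exact hab 0 h
  | succ k ih =>
    intro hk
    obtain ⟨w, hw⟩ := ih (by omega)
    obtain ⟨z, hz⟩ := hab (k + 1) hk
    obtain ⟨q1, q2⟩ := (Ma k (by omega)).fwd h1 h2 hw.mem.1 hz.1
    obtain ⟨q3, -⟩ := (Mb k (by omega)).fwd h1 h2 hw.mem.2 hz.2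
    obtain ⟨q4, q5⟩ := (Ma k (by omega)).back h1 h2 hw.mem.1 q1 q2
    obtain ⟨q6, -⟩ := (Mb k (by omega)).back h1 h2 hw.mem.2 q3 q2
    exact ⟨_, ⟨q1, q3⟩, Good.move h1 h2 Ma Mb k (by omega) w _ hw ⟨q4, q6⟩ q5⟩

theorem expansive (h1 : S.epsOne ε') (h2 : S.epsTwo ε' ε'') (x y : X) (N : ℕ)
    (h : ∀ j : ℤ, |j| ≤ N → dist ((S.phi ^ j) x) ((S.phi ^ j) y) ≤ ε'') :
    dist x y ≤ S.lam⁻¹ ^ N * (ε' / 2) := by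
  have e1 := h1.1
  have e2 := h1.2.1
  have e3 := h2.1
  have e4 := h2.2.1
  have hl : 0 < S.lam⁻¹ := inv_pos.2 (by linarith [S.one_lt_lam])
  have succ_app : ∀ (j : ℤ) (u : X), (S.phi ^ (j + 1)) u = S.phi ((S.phi ^ j) u) := by
    intro j u
    rw [add_comm, zpow_add, Equiv.Perm.mul_apply, zpow_one]
  have stepc : ∀ j : ℤ, |j| ≤ N → |j + 1| ≤ N →
      S.phi (S.bracket ((S.phi ^ j) x) ((S.phi ^ j) y)) =
        S.bracket ((S.phi ^ (j + 1)) x) ((S.phi ^ (j + 1)) y) := by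
    intro j hj hj'
    have a1 := h j hj
    have a2 := h _ hj'
    rw [succ_app, succ_app] at a2 ⊢
    exact S.bracket_phi _ _ (by linarith) (by linarith)
  have as1 : ∀ u v : X, dist u v ≤ ε'' → dist u (S.bracket u v) ≤ ε' / 4 ∧
      dist v (S.bracket u v) ≤ ε' / 4 ∧
      S.bracket u (S.bracket u v) = S.bracket u v ∧
      S.bracket (S.bracket u v) v = S.bracket u v := by
    intro u v huv
    obtain ⟨-, b1, b2⟩ := h2.2.2 u v huv
    have b3 := b1
    rw [dist_comm] at b3
    have b4 := b2
    rw [dist_comm] at b4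
    exact ⟨b3, b4, S.bracket_assoc₁ _ _ _ (by linarith) (by linarith) (by linarith),
      S.bracket_assoc₂ _ _ _ (by linarith) (by linarith) (by linarith)⟩
  have hx : ∀ k : ℕ, k ≤ N →
      dist ((S.phi ^ ((k : ℤ) - N)) x)
        (S.bracket ((S.phi ^ ((k : ℤ) - N)) x) ((S.phi ^ ((k : ℤ) - N)) y)) ≤
        S.lam⁻¹ ^ k * (ε' / 4) := by
    intro k
    induction k with
    | zero =>
      intro _
      simpa using (as1 _ _ (h (((0 : ℕ) : ℤ) - N) (by simp))).1
    | succ k ih =>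
      intro hk
      have ihk := ih (by omega)
      have r1 : |(k : ℤ) - N| ≤ N := by rw [abs_le]; omega
      have r2 : |(k : ℤ) - N + 1| ≤ N := by rw [abs_le]; omega
      have e : ((k + 1 : ℕ) : ℤ) - N = (k : ℤ) - N + 1 := by push_cast; ring
      rw [e, ← stepc _ r1 r2, succ_app]
      obtain ⟨c1, c2, c3, c4⟩ := as1 _ _ (h _ r1)
      have := S.contract_s ((S.phi ^ ((k : ℤ) - N)) x) S.eps S.eps_pos le_rfl
        ((S.phi ^ ((k : ℤ) - N)) x) _ (by simpa using S.eps_pos) (S.bracket_self _)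
        (by linarith) c3
      refine this.trans ?_
      rw [pow_succ', mul_assoc]
      exact mul_le_mul_of_nonneg_left ihk hl.le
  have hy : ∀ k : ℕ, k ≤ N →
      dist ((S.phi ^ ((N : ℤ) - k)) y)
        (S.bracket ((S.phi ^ ((N : ℤ) - k)) x) ((S.phi ^ ((N : ℤ) - k)) y)) ≤
        S.lam⁻¹ ^ k * (ε' / 4) := by
    intro k
    induction k with
    | zero =>
      intro _
      simpa using (as1 _ _ (h ((N : ℤ) - ((0 : ℕ) : ℤ)) (by simp))).2.1
    | succ k ih =>
      intro hk
      have ihk := ih (by omega)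
      obtain ⟨j, hj⟩ : ∃ j : ℤ, j = (N : ℤ) - ((k + 1 : ℕ) : ℤ) := ⟨_, rfl⟩
      have e : (N : ℤ) - k = j + 1 := by rw [hj]; push_cast; ring
      rw [e] at ihk
      rw [← hj]
      have r1 : |j| ≤ N := by rw [abs_le]; omega
      have r2 : |j + 1| ≤ N := by rw [abs_le]; omega
      obtain ⟨c1, c2, c3, c4⟩ := as1 _ _ (h _ r2)
      have := S.contract_u ((S.phi ^ (j + 1)) y) S.eps S.eps_pos le_rfl
        ((S.phi ^ (j + 1)) y) _ (by simpa using S.eps_pos) (S.bracket_self _)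
        (by linarith) c4
      rw [← stepc _ r1 r2, succ_app, Equiv.symm_apply_apply, Equiv.symm_apply_apply,
        ← succ_app, stepc _ r1 r2] at this
      refine this.trans ?_
      rw [pow_succ', mul_assoc]
      exact mul_le_mul_of_nonneg_left ihk hl.le
  have fx := hx N le_rfl
  have fy := hy N le_rfl
  simp only [sub_self, zpow_zero, Equiv.Perm.coe_one, id] at fx fy
  have := dist_triangle_right x y (S.bracket x y)
  linarith

end SmaleSpace

theorem SmaleSpace.trans_of_seq {X : Type*} [MetricSpace X]
    [CompactSpace X] (S : SmaleSpace X) (ε' ε'' : ℝ)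
    (h1 : S.epsOne ε') (h2 : S.epsTwo ε' ε'')
    (R1 : Set (Set X)) (hMP : S.IsMarkovPartition ε' R1)
    (hdiam : ∀ R ∈ R1, diam R ≤ ε'') (n : ℕ) (g : ℤ → Set X) (hg : ∀ i, g i ∈ R1)
    (hint : (interior (⋂ i ∈ Finset.Icc (-(n : ℤ)) (n : ℤ), (⇑(S.phi ^ i)) ⁻¹' (g i))).Nonempty) :
    ∀ k < 2 * n, S.Trans ε' ε'' (g ((k : ℤ) - n)) (g (((k + 1 : ℕ) : ℤ) - n)) := by
  intro k hk
  obtain ⟨p, hp⟩ := hint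
  have hpi : ∀ i : ℤ, -(n : ℤ) ≤ i → i ≤ n → (S.phi ^ i) p ∈ interior (g i) := by
    intro i hi hi'
    refine S.zpow_mem_interior i ?_ hp
    exact Set.biInter_subset_of_mem (by simp [hi, hi'])
  have hd : ∀ A ∈ R1, ∀ x ∈ A, ∀ y ∈ A, dist x y ≤ ε'' := fun A hA x hx y hy =>
    (dist_le_diam_of_mem (Metric.isBounded_of_compactSpace) hx hy).trans (hdiam A hA)
  have p1 := hpi ((k : ℤ) - n) (by omega) (by omega)
  have p2 := hpi (((k + 1 : ℕ) : ℤ) - n) (by omega) (by omega)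
  have e : (S.phi ^ (((k + 1 : ℕ) : ℤ) - n)) p = S.phi ((S.phi ^ ((k : ℤ) - n)) p) := by
    have : ((k + 1 : ℕ) : ℤ) - n = 1 + ((k : ℤ) - n) := by push_cast; ring
    rw [this, zpow_add, Equiv.Perm.mul_apply, zpow_one]
  rw [e] at p2
  obtain ⟨-, -, hprop, -, hM⟩ := hMP
  exact ⟨(hprop _ (hg _)).1.2.2, (hprop _ (hg _)).1.2.2, hd _ (hg _), hd _ (hg _),
    _, interior_subset p1, interior_subset p2, hM _ (hg _) _ (hg _) _ p1 p2⟩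

/-- Controlled normality of Smale spaces: there is `N ∈ ℕ` such that for every
`n ≥ 1` and disjoint `R, S ∈ ℛ_n`, no element of `ℛ_{n+N}` meeting `R` also
meets an element of `ℛ_{n+N}` meeting `S`, i.e.
`N_{ℛ_{n+N}}(R) ∩ N_{ℛ_{n+N}}(S) = ∅`. -/
theorem markovSeq_separation {X : Type*} [MetricSpace X]
    [CompactSpace X] (S : SmaleSpace X) (ε' ε'' : ℝ)
    (hε' : S.epsOne ε') (hε'' : S.epsTwo ε' ε'')
    (hirr : IrreducibleSystem ⇑S.phi)
    (R1 : Set (Set X)) (hMP : S.IsMarkovPartition ε' R1)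
    (hdiam : ∀ R ∈ R1, diam R ≤ ε'') :
    ∃ N : ℕ, ∀ n : ℕ, 1 ≤ n → ∀ R ∈ S.markovSeq R1 n, ∀ R' ∈ S.markovSeq R1 n,
      Disjoint R R' →
      nbr (S.markovSeq R1 (n + N)) R ∩ nbr (S.markovSeq R1 (n + N)) R' = ∅ := by
  have hfin := hMP.1
  have hl0 : 0 ≤ S.lam⁻¹ := inv_nonneg.2 (by linarith [S.one_lt_lam])
  have hl1 : S.lam⁻¹ < 1 := inv_lt_one_of_one_lt₀ S.one_lt_lam
  have htend : Filter.Tendsto (fun N : ℕ => S.lam⁻¹ ^ N * (ε' / 2)) Filter.atTop (𝓝 0) := by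
    simpa using (tendsto_pow_atTop_nhds_zero_of_lt_one hl0 hl1).mul_const (ε' / 2)
  have hev : ∀ᶠ N : ℕ in Filter.atTop, ∀ A ∈ R1, ∀ B ∈ R1, Disjoint A B →
      ∀ x ∈ A, ∀ y ∈ B, S.lam⁻¹ ^ N * (ε' / 2) < dist x y := by
    rw [Filter.eventually_all_finite hfin]
    intro A hA
    rw [Filter.eventually_all_finite hfin]
    intro B hB
    by_cases hAB : Disjoint A B
    · obtain ⟨r, hr, hrd⟩ := exists_pos_forall_lt_edist
        ((hMP.2.2.1 A hA).2.1.isCompact) (hMP.2.2.1 B hB).2.1 hAB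
      filter_upwards [htend.eventually_lt_const (show (0 : ℝ) < r from hr)] with N hN
      intro _ x hx y hy
      have := hrd x hx y hy
      rw [edist_nndist] at this
      have h3 : r < nndist x y := by exact_mod_cast this
      have h4 : (r : ℝ) < dist x y := by rw [← coe_nndist]; exact_mod_cast h3
      exact hN.trans h4
    · exact Filter.Eventually.of_forall fun N h => absurd h hAB
  obtain ⟨N, hN⟩ := hev.exists
  refine ⟨N, ?_⟩
  intro n hn R hR R' hR' hdisj
  obtain ⟨m, rfl⟩ : ∃ m, n = m + 1 := ⟨n - 1, by omega⟩
  obtain ⟨hRi, g, hg, rfl⟩ := hR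
  obtain ⟨hRi', g', hg', rfl⟩ := hR'
  rw [Set.eq_empty_iff_forall_notMem]
  rintro T ⟨⟨hT, x, hxT, hxR⟩, ⟨-, y, hyT, hyR⟩⟩
  rw [show m + 1 + N = (m + N) + 1 by ring] at hT
  obtain ⟨-, h, hh, rfl⟩ := hT
  have key : ∀ i : ℤ, -(m : ℤ) ≤ i → i ≤ m → (g i ∩ g' i).Nonempty := by
    intro i hi hi'
    rw [← Set.not_disjoint_iff_nonempty_inter]
    intro hd
    have hx := Set.mem_iInter₂.1 hxR i (by simp [hi, hi'])
    have hy := Set.mem_iInter₂.1 hyR i (by simp [hi, hi'])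
    have h5 := hN _ (hg i) _ (hg' i) hd _ hx _ hy
    have h6 := SmaleSpace.expansive hε' hε'' ((S.phi ^ i) x) ((S.phi ^ i) y) N ?_
    · linarith
    intro j hj
    rw [abs_le] at hj
    have hmem : j + i ∈ Finset.Icc (-((m + N : ℕ) : ℤ)) ((m + N : ℕ) : ℤ) := by
      rw [Finset.mem_Icc]; omega
    have hx : (S.phi ^ (j + i)) x ∈ h (j + i) := Set.mem_iInter₂.1 hxT (j + i) hmem
    have hy : (S.phi ^ (j + i)) y ∈ h (j + i) := Set.mem_iInter₂.1 hyT (j + i) hmem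
    rw [← Equiv.Perm.mul_apply, ← Equiv.Perm.mul_apply, ← zpow_add]
    exact (dist_le_diam_of_mem (Metric.isBounded_of_compactSpace) hx hy).trans (hdiam _ (hh _))
  obtain ⟨w, hw⟩ := SmaleSpace.exists_good (a := fun k => g ((k : ℤ) - m))
    (b := fun k => g' ((k : ℤ) - m)) hε' hε''
    (S.trans_of_seq ε' ε'' hε' hε'' R1 hMP hdiam m g hg hRi)
    (S.trans_of_seq ε' ε'' hε' hε'' R1 hMP hdiam m g' hg' hRi')
    (fun k hk => key _ (by omega) (by omega)) (2 * m) le_rfl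
  have hfinal : ∀ i ∈ Finset.Icc (-(m : ℤ)) (m : ℤ),
      (S.phi ^ i) ((S.phi ^ (-(m : ℤ))) w) ∈ g i ∩ g' i := by
    intro i hi
    rw [Finset.mem_Icc] at hi
    have h7 := hw.orbit (i + m).toNat (by omega)
    have e1 : (((i + m).toNat : ℕ) : ℤ) = i + m := Int.toNat_of_nonneg (by omega)
    simp only [e1] at h7
    rw [← Equiv.Perm.mul_apply, ← zpow_add]
    have e2 : i + (m : ℤ) - ((2 * m : ℕ) : ℤ) = i + -(m : ℤ) := by push_cast; ring
    rw [e2, add_sub_cancel_right] at h7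
    exact h7
  exact Set.disjoint_left.1 hdisj
    (Set.mem_iInter₂.2 fun i hi => (hfinal i hi).1)
    (Set.mem_iInter₂.2 fun i hi => (hfinal i hi).2)
end

section
/- Let (X,d,φ) be an irreducible Smale space and ℛ₁ a Markov partition of X with diam(R) ≤ ε''_X for every R ∈ ℛ₁, giving rise to the refining sequence (ℛ_n)_{n≥0} of Markov partitions. Let N ∈ ℕ be such that for every n ≥ 1 and all disjoint R,S ∈ ℛ_n one has N_{ℛ_{n+N}}(R) ∩ N_{ℛ_{n+N}}(S) = ∅. Then for every n ≥ N+2 and every R ∈ ℛ_n, #N_{ℛ_n}(R) ≤ (#ℛ₁)^{2(N+1)}. Consequently, sup_{n ≥ 1} max_{R ∈ ℛ_n} #N_{ℛ_n}(R) < ∞, where N_𝒰(Y) = {U ∈ 𝒰 : U ∩ Y ≠ ∅}. -/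
open Set Metric MeasureTheory Topology
open scoped ENNReal NNReal

open Set Metric Topology
open scoped ENNReal

section helpers

variable {X : Type*} [MetricSpace X] [CompactSpace X]

theorem aux_dist_le {R : Set X} {r : ℝ} (h : diam R ≤ r) {x y : X} (hx : x ∈ R) (hy : y ∈ R) :
    dist x y ≤ r :=
  (dist_le_diam_of_mem (isBounded_of_compactSpace) hx hy).trans h

theorem aux_mem (S : SmaleSpace X) (ε' ε'' : ℝ)
    (hε' : S.epsOne ε') (hε'' : S.epsTwo ε' ε'')
    (R1 : Set (Set X)) (hMP : S.IsMarkovPartition ε' R1)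
    (hdiam : ∀ R ∈ R1, diam R ≤ ε'') (L : ℕ) (c d : ℕ → Set X)
    (hc : ∀ k, c k ∈ R1) (hd : ∀ k, d k ∈ R1) (z : X)
    (hzc : ∀ k ≤ L, S.phi^[k] z ∈ c k) (hzd : ∀ k ≤ L, S.phi^[k] z ∈ d k)
    (h0 : c 0 = d 0) (hL : c L = d L) (u v : X)
    (hu : ∀ k ≤ L, S.phi^[k] u ∈ interior (c k))
    (hv : ∀ k ≤ L, S.phi^[k] v ∈ interior (d k)) :
    ∀ k ≤ L, S.phi^[k] (S.bracket u v) ∈ c k ∧ S.phi^[k] (S.bracket u v) ∈ d k := by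
  obtain ⟨he0, he1, -⟩ := hε'
  obtain ⟨hf0, hf1, -⟩ := hε''
  obtain ⟨-, -, hrect, -, hmark⟩ := hMP
  have hduv : ∀ k ≤ L, dist (S.phi^[k] u) (S.phi^[k] v) ≤ S.eps := by
    intro k hk
    have h1 := aux_dist_le (hdiam _ (hc k)) (interior_subset (hu k hk)) (hzc k hk)
    have h2 := aux_dist_le (hdiam _ (hd k)) (hzd k hk) (interior_subset (hv k hk))
    have := dist_triangle (S.phi^[k] u) (S.phi^[k] z) (S.phi^[k] v)
    linarith
  have hbr : ∀ k ≤ L, S.phi^[k] (S.bracket u v) = S.bracket (S.phi^[k] u) (S.phi^[k] v) := by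
    intro k
    induction k with
    | zero => intro _; rfl
    | succ k ih =>
      intro hk
      have h1 := hduv k (by omega)
      have h2 := hduv (k+1) hk
      rw [Function.iterate_succ_apply', Function.iterate_succ_apply'] at h2
      rw [Function.iterate_succ_apply', ih (by omega), S.bracket_phi _ _ h1 h2,
        Function.iterate_succ_apply', Function.iterate_succ_apply']
  have hfw : ∀ k ≤ L, S.phi^[k] (S.bracket u v) ∈ S.stableIn ε' (S.phi^[k] u) (c k) := by
    intro k
    induction k with
    | zero =>
      intro hk
      have hu0 : u ∈ c 0 := interior_subset (hu 0 hk)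
      have hv0 : v ∈ c 0 := h0 ▸ interior_subset (hv 0 hk)
      have hw : S.bracket u v ∈ c 0 := (hrect _ (hc 0)).1.2.2 u hu0 v hv0
      have hd1 := aux_dist_le (hdiam _ (hc 0)) hu0 hw
      have hd2 := aux_dist_le (hdiam _ (hc 0)) hu0 hv0
      exact ⟨⟨lt_of_le_of_lt hd1 (by linarith),
        S.bracket_assoc₁ u u v (by linarith) (by linarith) (by linarith)⟩, hw⟩
    | succ k ih =>
      intro hk
      have h2 := hu (k+1) hk
      rw [Function.iterate_succ_apply'] at h2
      rw [Function.iterate_succ_apply', Function.iterate_succ_apply']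
      exact (hmark _ (hc k) _ (hc (k+1)) _ (hu k (by omega)) h2).2
        (mem_image_of_mem _ (ih (by omega)))
  have hbw : ∀ j k, k + j = L →
      S.phi^[k] (S.bracket u v) ∈ S.unstableIn ε' (S.phi^[k] v) (d k) := by
    intro j
    induction j with
    | zero =>
      intro k hk
      obtain rfl : k = L := by omega
      have hw := (hfw k le_rfl).2
      have hvL := interior_subset (hv k le_rfl)
      have huL := interior_subset (hu k le_rfl)
      rw [hL] at hw huL
      have hd1 := aux_dist_le (hdiam _ (hd k)) hvL hw
      refine ⟨⟨lt_of_le_of_lt hd1 (by linarith), ?_⟩, hw⟩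
      have := hduv k le_rfl
      rw [dist_comm] at hd1
      rw [hbr k le_rfl] at hd1 ⊢
      exact S.bracket_assoc₂ _ _ _ this (by linarith) this
    | succ j ih =>
      intro k hk
      have h1 := ih (k+1) (by omega)
      have h2 := hv (k+1) (by omega)
      rw [Function.iterate_succ_apply'] at h2
      rw [Function.iterate_succ_apply', Function.iterate_succ_apply'] at h1
      obtain ⟨p, hp, hpe⟩ := (hmark _ (hd k) _ (hd (k+1)) _ (hv k (by omega)) h2).1 h1
      rwa [← S.phi.injective hpe]
  intro k hk
  exact ⟨(hfw k hk).2, (hbw (L-k) k (by omega)).2⟩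

theorem aux_contAt (S : SmaleSpace X) {x y : X} (h : dist x y < S.eps) :
    ContinuousAt (fun p : X × X => S.bracket p.1 p.2) (x, y) := by
  apply S.bracket_cont.continuousAt
  have : IsOpen {p : X × X | dist p.1 p.2 < S.eps} :=
    isOpen_lt (by fun_prop) (by fun_prop)
  exact Filter.mem_of_superset (this.mem_nhds h) (fun p hp => (show dist p.1 p.2 < S.eps from hp).le)

theorem aux_word (S : SmaleSpace X) (ε' ε'' : ℝ)
    (hε' : S.epsOne ε') (hε'' : S.epsTwo ε' ε'')
    (R1 : Set (Set X)) (hMP : S.IsMarkovPartition ε' R1)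
    (hdiam : ∀ R ∈ R1, diam R ≤ ε'') (L : ℕ) (c d : ℕ → Set X)
    (hc : ∀ k, c k ∈ R1) (hd : ∀ k, d k ∈ R1) (z : X)
    (hzc : ∀ k ≤ L, S.phi^[k] z ∈ c k) (hzd : ∀ k ≤ L, S.phi^[k] z ∈ d k)
    (h0 : c 0 = d 0) (hL : c L = d L) (u v : X)
    (hu : ∀ k ≤ L, S.phi^[k] u ∈ interior (c k))
    (hv : ∀ k ≤ L, S.phi^[k] v ∈ interior (d k)) :
    ∀ k ≤ L, c k = d k := by
  have key := aux_mem S ε' ε'' hε' hε'' R1 hMP hdiam L c d hc hd z hzc hzd h0 hL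
  obtain ⟨he0, he1, -⟩ := hε'
  obtain ⟨hf0, hf1, -⟩ := hε''
  have hcont : ∀ k, Continuous (S.phi^[k]) := fun k => S.phi_cont.iterate k
  have hopen : ∀ e : ℕ → Set X, IsOpen {p | ∀ k ≤ L, S.phi^[k] p ∈ interior (e k)} := by
    intro e
    have : {p | ∀ k ≤ L, S.phi^[k] p ∈ interior (e k)} =
        ⋂ k ∈ Set.Iic L, S.phi^[k] ⁻¹' interior (e k) := by
      ext p; simp
    rw [this]
    exact (Set.finite_Iic L).isOpen_biInter (fun k _ => isOpen_interior.preimage (hcont k))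
  set w := S.bracket u v with hw
  have hu0 : u ∈ c 0 := interior_subset (hu 0 (Nat.zero_le _))
  have hv0 : v ∈ c 0 := h0 ▸ interior_subset (hv 0 (Nat.zero_le _))
  have hw0 : w ∈ c 0 := (key u v hu hv 0 (Nat.zero_le _)).1
  have D := hdiam _ (hc 0)
  have duv := aux_dist_le D hu0 hv0
  have dwu := aux_dist_le D hw0 hu0
  have dvw := aux_dist_le D hv0 hw0
  have e1 : S.bracket w u = u := by
    rw [hw, S.bracket_assoc₂ u v u (by linarith) (by linarith) (by simp; linarith),
      S.bracket_self]
  have e2 : S.bracket v w = v := by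
    rw [hw, S.bracket_assoc₁ v u v (by linarith) (by linarith) (by simp; linarith),
      S.bracket_self]
  have c1 : Filter.Tendsto (fun p => S.bracket p u) (𝓝 w) (𝓝 u) := by
    have h1 : ContinuousAt (fun p : X => (p, u)) w := by fun_prop
    have := ContinuousAt.comp (f := fun p : X => (p, u)) (aux_contAt S (x := w) (y := u) (by linarith)) h1
    simpa [ContinuousAt, Function.comp_def, e1] using this
  have c2 : Filter.Tendsto (fun p => S.bracket v p) (𝓝 w) (𝓝 v) := by
    have h1 : ContinuousAt (fun p : X => (v, p)) w := by fun_prop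
    have := ContinuousAt.comp (f := fun p : X => (v, p)) (aux_contAt S (x := v) (y := w) (by linarith)) h1
    simpa [ContinuousAt, Function.comp_def, e2] using this
  have ev1 := c1.eventually ((hopen c).mem_nhds hu)
  have ev2 := c2.eventually ((hopen d).mem_nhds hv)
  have ev3 : ∀ᶠ p in 𝓝 w, dist p w < ε'' := ball_mem_nhds w hf0
  have ev : ∀ᶠ p in 𝓝 w, ∀ k ≤ L, S.phi^[k] p ∈ c k ∧ S.phi^[k] p ∈ d k := by
    filter_upwards [ev1, ev2, ev3] with p h1 h2 h3
    have hx0 : S.bracket p u ∈ c 0 := interior_subset (h1 0 (Nat.zero_le _))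
    have hy0 : S.bracket v p ∈ c 0 := h0 ▸ interior_subset (h2 0 (Nat.zero_le _))
    have dxy := aux_dist_le D hx0 hy0
    have dwy := aux_dist_le D hw0 hy0
    have dpu := dist_triangle p w u
    have dpy := dist_triangle p w (S.bracket v p)
    have dvp := dist_triangle v w p
    rw [dist_comm w p] at dvp
    have e : S.bracket (S.bracket p u) (S.bracket v p) = p := by
      rw [S.bracket_assoc₂ p u _ (by linarith) (by linarith) (by linarith),
        S.bracket_assoc₁ p v p (by linarith) (by linarith) (by simp; linarith), S.bracket_self]
    have := key _ _ h1 h2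
    rwa [e] at this
  intro k hk
  by_contra hne
  have hdis := hMP.2.2.2.1 _ (hc k) _ (hd k) hne
  let H : X ≃ₜ X := ⟨S.phi, S.phi_cont, S.phi_symm_cont⟩
  have hop : IsOpenMap (S.phi^[k]) := by
    have : IsOpenMap S.phi := H.isOpenMap
    clear hk hne hdis
    induction k with
    | zero => exact IsOpenMap.id
    | succ k ih => rw [Function.iterate_succ]; exact ih.comp this
  have hin : ∀ e : Set X, (∀ᶠ p in 𝓝 w, S.phi^[k] p ∈ e) → S.phi^[k] w ∈ interior e := by
    intro e he
    rw [mem_interior_iff_mem_nhds]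
    exact Filter.mem_of_superset (hop.image_mem_nhds he) (by rintro _ ⟨p, hp, rfl⟩; exact hp)
  have : S.phi^[k] w ∈ interior (c k) ∩ interior (d k) :=
    ⟨hin _ (ev.mono fun p hp => (hp k hk).1), hin _ (ev.mono fun p hp => (hp k hk).2)⟩
  rw [hdis] at this
  exact this

theorem aux_zpow_cont (S : SmaleSpace X) (i : ℤ) : Continuous ⇑(S.phi ^ i) := by
  have hn : ∀ k : ℕ, Continuous ⇑(S.phi ^ k) := fun k => by
    rw [Equiv.Perm.coe_pow]; exact S.phi_cont.iterate k
  have hs : ∀ k : ℕ, Continuous ⇑(S.phi⁻¹ ^ k) := fun k => by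
    rw [Equiv.Perm.coe_pow]; exact Continuous.iterate S.phi_symm_cont k
  rcases Int.eq_nat_or_neg i with ⟨k, rfl | rfl⟩
  · simpa using hn k
  · simpa using hs k

theorem aux_int (S : SmaleSpace X) (i : ℤ) (A : Set X) {x : X}
    (hx : x ∈ interior (⇑(S.phi ^ i) ⁻¹' A)) : (S.phi ^ i) x ∈ interior A := by
  rw [mem_interior_iff_mem_nhds] at hx ⊢
  have h1 : Filter.Tendsto ⇑(S.phi ^ (-i)) (𝓝 ((S.phi ^ i) x)) (𝓝 x) := by
    have := (aux_zpow_cont S (-i)).tendsto ((S.phi ^ i) x)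
    simpa using this
  filter_upwards [h1 hx] with p hp
  simpa using hp

/-- cylinder set -/
def cyl (S : SmaleSpace X) (g : ℤ → Set X) (M : ℕ) : Set X :=
  ⋂ i ∈ Finset.Icc (-(M : ℤ)) (M : ℤ), (⇑(S.phi ^ i)) ⁻¹' (g i)

theorem mem_cyl (S : SmaleSpace X) (g : ℤ → Set X) (M : ℕ) (x : X) :
    x ∈ cyl S g M ↔ ∀ i : ℤ, -(M : ℤ) ≤ i → i ≤ M → (S.phi ^ i) x ∈ g i := by
  simp [cyl]

theorem aux_cyl_int (S : SmaleSpace X) (g : ℤ → Set X) (M : ℕ) {x : X}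
    (hx : x ∈ interior (cyl S g M)) (i : ℤ) (h1 : -(M : ℤ) ≤ i) (h2 : i ≤ M) :
    (S.phi ^ i) x ∈ interior (g i) := by
  apply aux_int
  exact interior_mono (fun p hp => (mem_cyl S g M p).1 hp i h1 h2) hx

theorem aux_cyl (S : SmaleSpace X) (ε' ε'' : ℝ)
    (hε' : S.epsOne ε') (hε'' : S.epsTwo ε' ε'')
    (R1 : Set (Set X)) (hMP : S.IsMarkovPartition ε' R1)
    (hdiam : ∀ R ∈ R1, diam R ≤ ε'') (M : ℕ) (a b : ℤ → Set X)
    (ha : ∀ k, a k ∈ R1) (hb : ∀ k, b k ∈ R1)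
    (hai : (interior (cyl S a M)).Nonempty) (hbi : (interior (cyl S b M)).Nonempty)
    (hab : (cyl S a M ∩ cyl S b M).Nonempty)
    (h0 : a (-M) = b (-M)) (hL : a M = b M) (i : ℤ) (h1 : -(M : ℤ) ≤ i) (h2 : i ≤ M) :
    a i = b i := by
  obtain ⟨x, hx⟩ := hai
  obtain ⟨y, hy⟩ := hbi
  obtain ⟨z, hza, hzb⟩ := hab
  have hit : ∀ (k : ℕ) (p : X), S.phi^[k] ((S.phi ^ (-(M:ℤ))) p) = (S.phi ^ ((k:ℤ) - M)) p := by
    intro k p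
    rw [← Equiv.Perm.coe_pow, ← zpow_natCast, ← Equiv.Perm.mul_apply, ← zpow_add]
    rfl
  have := aux_word S ε' ε'' hε' hε'' R1 hMP hdiam (2 * M) (fun k => a ((k:ℤ) - M))
    (fun k => b ((k:ℤ) - M)) (fun _ => ha _) (fun _ => hb _) ((S.phi ^ (-(M:ℤ))) z)
    (fun k hk => by rw [hit]; exact (mem_cyl S a M z).1 hza _ (by omega) (by omega))
    (fun k hk => by rw [hit]; exact (mem_cyl S b M z).1 hzb _ (by omega) (by omega))
    (by simpa using h0) (by
      have e : ((2 * M : ℕ) : ℤ) - M = M := by push_cast; ring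
      simp only [e]; exact hL)
    ((S.phi ^ (-(M:ℤ))) x) ((S.phi ^ (-(M:ℤ))) y)
    (fun k hk => by rw [hit]; exact aux_cyl_int S a M hx _ (by omega) (by omega))
    (fun k hk => by rw [hit]; exact aux_cyl_int S b M hy _ (by omega) (by omega))
    (i + M).toNat (by omega)
  have e : ((i + M).toNat : ℤ) - M = i := by omega
  simpa only [e] using this

theorem aux_cyl_congr (S : SmaleSpace X) (a b : ℤ → Set X) (M : ℕ)
    (h : ∀ i : ℤ, -(M : ℤ) ≤ i → i ≤ M → a i = b i) : cyl S a M = cyl S b M := by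
  ext x
  rw [mem_cyl, mem_cyl]
  exact forall_congr' fun i => forall_congr' fun h1 => forall_congr' fun h2 => by rw [h i h1 h2]

theorem aux_seq_finite (S : SmaleSpace X) (R1 : Set (Set X)) (hf : R1.Finite) (n : ℕ) :
    (S.markovSeq R1 n).Finite := by
  cases n with
  | zero => exact Set.finite_singleton _
  | succ n =>
    have := hf.to_subtype
    refine (Set.finite_range (fun f : (Finset.Icc (-(n:ℤ)) (n:ℤ)) → R1 =>
      cyl S (fun i => if h : i ∈ Finset.Icc (-(n:ℤ)) (n:ℤ) then (f ⟨i, h⟩ : Set X) else ∅) n)).subset ?_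
    rintro Q ⟨-, g, hg, rfl⟩
    refine ⟨fun i => ⟨g i, hg i⟩, ?_⟩
    refine aux_cyl_congr S _ g n ?_
    intro i h1 h2
    have : i ∈ Finset.Icc (-(n:ℤ)) (n:ℤ) := Finset.mem_Icc.2 ⟨h1, h2⟩
    rw [dif_pos this]

theorem aux_bound (S : SmaleSpace X) (ε' ε'' : ℝ)
    (hε' : S.epsOne ε') (hε'' : S.epsTwo ε' ε'')
    (R1 : Set (Set X)) (hMP : S.IsMarkovPartition ε' R1)
    (hdiam : ∀ R ∈ R1, diam R ≤ ε'') (N : ℕ)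
    (hN : ∀ n : ℕ, 1 ≤ n → ∀ R ∈ S.markovSeq R1 n, ∀ R' ∈ S.markovSeq R1 n,
      Disjoint R R' →
      nbr (S.markovSeq R1 (n + N)) R ∩ nbr (S.markovSeq R1 (n + N)) R' = ∅)
    (M : ℕ) (R : Set X) (hR : R ∈ S.markovSeq R1 (M + N + 1)) :
    (nbr (S.markovSeq R1 (M + N + 1)) R).ncard ≤ R1.ncard ^ (2 * (N + 1)) := by
  have hfin := hMP.1.to_subtype
  have hex : ∀ Q : nbr (S.markovSeq R1 (M + N + 1)) R, ∃ g : ℤ → Set X, (∀ i, g i ∈ R1) ∧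
      Q.1 = cyl S g (M + N) := fun Q => by
    obtain ⟨-, g, hg, h⟩ := Q.2.1
    exact ⟨g, hg, h⟩
  choose g hg hgQ using hex
  let F : nbr (S.markovSeq R1 (M + N + 1)) R → (Bool × Fin (N + 1) → R1) := fun Q q =>
    ⟨g Q (if q.1 then ((M + q.2.1 : ℕ) : ℤ) else -((M + q.2.1 : ℕ) : ℤ)), hg Q _⟩
  have hsub : ∀ Q, Q.1 ⊆ cyl S (g Q) M := by
    intro Q p hp
    rw [hgQ Q, mem_cyl] at hp
    rw [mem_cyl]
    intro i h1 h2
    exact hp i (by push_cast; omega) (by push_cast; omega)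
  have hint : ∀ Q, (interior (cyl S (g Q) M)).Nonempty := fun Q =>
    Q.2.1.1.mono (interior_mono (hsub Q))
  have hpar : ∀ Q, cyl S (g Q) M ∈ S.markovSeq R1 (M + 1) := fun Q =>
    ⟨hint Q, g Q, hg Q, rfl⟩
  have hnb : ∀ Q, R ∈ nbr (S.markovSeq R1 (M + 1 + N)) (cyl S (g Q) M) := by
    intro Q
    refine ⟨by rwa [show M + 1 + N = M + N + 1 by omega], ?_⟩
    obtain ⟨p, h1, h2⟩ := Q.2.2
    exact ⟨p, h2, hsub Q h1⟩
  have hF : Function.Injective F := by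
    intro Q Q' h
    have hpos : ∀ j : ℕ, j ≤ N → g Q ((M + j : ℕ) : ℤ) = g Q' ((M + j : ℕ) : ℤ) := by
      intro j hj
      simpa [F] using congrArg Subtype.val (congrFun h (true, ⟨j, by omega⟩))
    have hneg : ∀ j : ℕ, j ≤ N → g Q (-((M + j : ℕ) : ℤ)) = g Q' (-((M + j : ℕ) : ℤ)) := by
      intro j hj
      simpa [F] using congrArg Subtype.val (congrFun h (false, ⟨j, by omega⟩))
    have hmeet : (cyl S (g Q) M ∩ cyl S (g Q') M).Nonempty := by
      by_contra hcon
      have hdisj : Disjoint (cyl S (g Q) M) (cyl S (g Q') M) :=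
        Set.disjoint_iff_inter_eq_empty.2 (Set.not_nonempty_iff_eq_empty.1 hcon)
      have := hN (M + 1) (by omega) _ (hpar Q) _ (hpar Q') hdisj
      exact (Set.eq_empty_iff_forall_notMem.1 this) R ⟨hnb Q, hnb Q'⟩
    have hin := aux_cyl S ε' ε'' hε' hε'' R1 hMP hdiam M (g Q) (g Q') (hg Q) (hg Q')
      (hint Q) (hint Q') hmeet (hneg 0 (by omega)) (hpos 0 (by omega))
    apply Subtype.ext
    rw [hgQ Q, hgQ Q']
    apply aux_cyl_congr
    intro i h1 h2
    push_cast at h1 h2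
    by_cases hi : -(M : ℤ) ≤ i ∧ i ≤ M
    · exact hin i hi.1 hi.2
    · by_cases hp : 0 ≤ i
      · have := hpos (i - M).toNat (by omega)
        have e : ((M + (i - M).toNat : ℕ) : ℤ) = i := by omega
        rwa [e] at this
      · have := hneg (-i - M).toNat (by omega)
        have e : -((M + (-i - M).toNat : ℕ) : ℤ) = i := by omega
        rwa [e] at this
  have := Nat.card_le_card_of_injective F hF
  rw [Nat.card_fun] at this
  simpa [← Nat.card_coe_set_eq] using this

end helpers

/-- Neighbouring Rectangles Lemma: if `N` separates disjoint rectangles as in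
the controlled-normality property, then for `n ≥ N + 2` every `R ∈ ℛ_n` has at
most `(#ℛ₁)^{2(N+1)}` neighbours; consequently, the number of neighbours is
uniformly bounded over all `n ≥ 1`. -/
theorem markovSeq_neighbouring_rectangles {X : Type*} [MetricSpace X]
    [CompactSpace X] (S : SmaleSpace X) (ε' ε'' : ℝ)
    (hε' : S.epsOne ε') (hε'' : S.epsTwo ε' ε'')
    (hirr : IrreducibleSystem ⇑S.phi)
    (R1 : Set (Set X)) (hMP : S.IsMarkovPartition ε' R1)
    (hdiam : ∀ R ∈ R1, diam R ≤ ε'')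
    (N : ℕ)
    (hN : ∀ n : ℕ, 1 ≤ n → ∀ R ∈ S.markovSeq R1 n, ∀ R' ∈ S.markovSeq R1 n,
      Disjoint R R' →
      nbr (S.markovSeq R1 (n + N)) R ∩ nbr (S.markovSeq R1 (n + N)) R' = ∅) :
    (∀ n : ℕ, N + 2 ≤ n → ∀ R ∈ S.markovSeq R1 n,
      (nbr (S.markovSeq R1 n) R).ncard ≤ R1.ncard ^ (2 * (N + 1))) ∧
    ∃ B : ℕ, ∀ n : ℕ, 1 ≤ n → ∀ R ∈ S.markovSeq R1 n,
      (nbr (S.markovSeq R1 n) R).ncard ≤ B := by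
  have hA : ∀ n : ℕ, N + 2 ≤ n → ∀ R ∈ S.markovSeq R1 n,
      (nbr (S.markovSeq R1 n) R).ncard ≤ R1.ncard ^ (2 * (N + 1)) := by
    intro n hn R hR
    obtain ⟨M, rfl⟩ : ∃ M, n = M + N + 1 := ⟨n - N - 1, by omega⟩
    exact aux_bound S ε' ε'' hε' hε'' R1 hMP hdiam N hN M R hR
  refine ⟨hA, R1.ncard ^ (2 * (N + 1)) + ∑ n ∈ Finset.range (N + 2), (S.markovSeq R1 n).ncard, ?_⟩
  intro n _ R hR
  by_cases h : N + 2 ≤ n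
  · exact (hA n h R hR).trans (Nat.le_add_right _ _)
  · have h1 : (nbr (S.markovSeq R1 n) R).ncard ≤ (S.markovSeq R1 n).ncard :=
      Set.ncard_le_ncard (fun Q hQ => hQ.1) (aux_seq_finite S R1 hMP.1 n)
    have h2 := Finset.single_le_sum (f := fun n => (S.markovSeq R1 n).ncard)
      (fun _ _ => Nat.zero_le _) (Finset.mem_range.2 (by omega : n < N + 2))
    exact (h1.trans h2).trans (Nat.le_add_left _ _)
end

section
/- Let (X,d,φ) be a Smale space and R ⊆ X a closed rectangle. Then the maps from R to the space of nonempty compact subsets of X equipped with the Hausdorff metric given by x ↦ X^s(x,R) and x ↦ X^u(x,R) are continuous. In particular, the maps x ↦ diam(X^s(x,R)) and x ↦ diam(X^u(x,R)) are continuous on R. -/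
open Set Metric MeasureTheory Topology
open scoped ENNReal NNReal

open Set Metric Topology
open scoped ENNReal

theorem leaf_aux {X : Type*} [MetricSpace X] (R : Set X) (hRc : IsCompact R) (f : X → X → X)
    (hf : ContinuousOn (fun p : X × X => f p.1 p.2) (R ×ˢ R))
    (hm : ∀ x ∈ R, ∀ y ∈ R, f x y ∈ R)
    (hi : ∀ x ∈ R, ∀ y ∈ R, f x (f x y) = f x y) (L : X → Set X)
    (hL : ∀ x ∈ R, ∀ y, y ∈ L x ↔ y ∈ R ∧ f x y = y) :
    ∀ ε : ℝ, 0 < ε → ∃ δ : ℝ, 0 < δ ∧ ∀ x ∈ R, ∀ x' ∈ R, dist x x' < δ →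
      ∀ y ∈ L x, ∃ y' ∈ L x', dist y y' < ε := by
  intro ε hε
  have hu := (hRc.prod hRc).uniformContinuousOn_of_continuous hf
  rw [Metric.uniformContinuousOn_iff] at hu
  obtain ⟨δ, hδ, h⟩ := hu ε hε
  refine ⟨δ, hδ, fun x hx x' hx' hd y hy => ?_⟩
  obtain ⟨hyR, hyf⟩ := (hL x hx y).1 hy
  refine ⟨f x' y, (hL x' hx' _).2 ⟨hm x' hx' y hyR, hi x' hx' y hyR⟩, ?_⟩
  have := h (x, y) ⟨hx, hyR⟩ (x', y) ⟨hx', hyR⟩ (by simpa [Prod.dist_eq] using hd)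
  simpa [hyf] using this

theorem leaf_hd {X : Type*} [MetricSpace X] (R : Set X) (L : X → Set X)
    (h : ∀ ε : ℝ, 0 < ε → ∃ δ : ℝ, 0 < δ ∧ ∀ x ∈ R, ∀ x' ∈ R, dist x x' < δ →
      ∀ y ∈ L x, ∃ y' ∈ L x', dist y y' < ε) :
    ∀ ε : ℝ, 0 < ε → ∃ δ : ℝ, 0 < δ ∧ ∀ x ∈ R, ∀ x' ∈ R, dist x x' < δ →
      Metric.hausdorffEDist (L x) (L x') < ENNReal.ofReal ε := by
  intro ε hε
  obtain ⟨δ, hδ, h⟩ := h (ε / 2) (by linarith)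
  refine ⟨δ, hδ, fun x hx x' hx' hd => ?_⟩
  refine lt_of_le_of_lt (b := ENNReal.ofReal (ε / 2)) ?_
    ((ENNReal.ofReal_lt_ofReal_iff hε).2 (by linarith))
  apply Metric.hausdorffEDist_le_of_mem_edist
  · intro y hy
    obtain ⟨y', hy', hd'⟩ := h x hx x' hx' hd y hy
    exact ⟨y', hy', by rw [edist_dist]; exact ENNReal.ofReal_le_ofReal hd'.le⟩
  · intro y hy
    obtain ⟨y', hy', hd'⟩ := h x' hx' x hx (by rwa [dist_comm]) y hy
    exact ⟨y', hy', by rw [edist_dist]; exact ENNReal.ofReal_le_ofReal hd'.le⟩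

theorem leaf_diam {X : Type*} [MetricSpace X] [CompactSpace X] (R : Set X) (L : X → Set X)
    (h : ∀ ε : ℝ, 0 < ε → ∃ δ : ℝ, 0 < δ ∧ ∀ x ∈ R, ∀ x' ∈ R, dist x x' < δ →
      ∀ y ∈ L x, ∃ y' ∈ L x', dist y y' < ε) :
    ContinuousOn (fun x : X => diam (L x)) R := by
  rw [Metric.continuousOn_iff]
  intro x₀ hx₀ ε hε
  obtain ⟨δ, hδ, h⟩ := h (ε / 4) (by linarith)
  have key : ∀ x ∈ R, ∀ x' ∈ R, dist x x' < δ → diam (L x) ≤ diam (L x') + ε / 2 := by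
    intro x hx x' hx' hd
    refine diam_le_of_forall_dist_le (by have := diam_nonneg (s := L x'); linarith) ?_
    intro y hy z hz
    obtain ⟨y', hy', hdy⟩ := h x hx x' hx' hd y hy
    obtain ⟨z', hz', hdz⟩ := h x hx x' hx' hd z hz
    have h1 : dist y' z' ≤ diam (L x') :=
      dist_le_diam_of_mem (isCompact_univ.isBounded.subset (subset_univ _)) hy' hz'
    have h2 := dist_triangle4 y y' z' z
    rw [dist_comm z' z] at h2
    linarith
  refine ⟨δ, hδ, fun x hx hd => ?_⟩
  have h1 := key x hx x₀ hx₀ hd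
  have h2 := key x₀ hx₀ x hx (by rwa [dist_comm])
  rw [Real.dist_eq, abs_lt]
  constructor <;> linarith

/-- For a closed rectangle `R` in a Smale space, the maps `x ↦ X^s(x,R)` and
`x ↦ X^u(x,R)` are continuous from `R` into the compact subsets of `X` with the
Hausdorff metric; in particular `x ↦ diam X^s(x,R)` and `x ↦ diam X^u(x,R)` are
continuous on `R`. -/
theorem rectangle_leaf_maps_continuous {X : Type*} [MetricSpace X]
    [CompactSpace X] (S : SmaleSpace X) (ε' : ℝ) (hε' : S.epsOne ε')
    (R : Set X) (hR : S.IsRectangle ε' R) (hRc : IsClosed R) :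
    (∀ x₀ ∈ R, ∀ ε : ℝ, 0 < ε → ∃ δ : ℝ, 0 < δ ∧ ∀ x ∈ R, dist x x₀ < δ →
      EMetric.hausdorffEdist (S.stableIn ε' x R) (S.stableIn ε' x₀ R) <
        ENNReal.ofReal ε ∧
      EMetric.hausdorffEdist (S.unstableIn ε' x R) (S.unstableIn ε' x₀ R) <
        ENNReal.ofReal ε) ∧
    ContinuousOn (fun x : X => diam (S.stableIn ε' x R)) R ∧
    ContinuousOn (fun x : X => diam (S.unstableIn ε' x R)) R := by
  obtain ⟨hpos, hle, -⟩ := hε'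
  obtain ⟨-, hdiam, hbr⟩ := hR
  have hcomp : IsCompact R := hRc.isCompact
  have hdist : ∀ x ∈ R, ∀ y ∈ R, dist x y ≤ ε' := fun x hx y hy =>
    (dist_le_diam_of_mem hcomp.isBounded hx hy).trans hdiam
  have hE : ε' ≤ S.eps := by have := S.eps_pos; linarith
  have hdE : ∀ x ∈ R, ∀ y ∈ R, dist x y ≤ S.eps := fun x hx y hy => (hdist x hx y hy).trans hE
  have hs := leaf_aux R hcomp (fun x y => S.bracket x y)
    (S.bracket_cont.mono fun p hp => hdE _ hp.1 _ hp.2) hbr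
    (fun x hx y hy => S.bracket_assoc₁ x x y (hdE _ hx _ hy) (hdE _ hx _ (hbr _ hx _ hy))
      (hdE _ hx _ hy)) (fun x => S.stableIn ε' x R) (by
      intro x hx y
      refine ⟨fun h => ⟨h.2, h.1.2⟩, fun h => ⟨⟨?_, h.2⟩, h.1⟩⟩
      have := hdist x hx y h.1
      linarith)
  have hu := leaf_aux R hcomp (fun x y => S.bracket y x)
    (S.bracket_cont.comp continuous_swap.continuousOn fun p hp => hdE _ hp.2 _ hp.1)
    (fun x hx y hy => hbr y hy x hx)
    (fun x hx y hy => S.bracket_assoc₂ y x x (hdE _ hy _ hx) (hdE _ (hbr _ hy _ hx) _ hx)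
      (hdE _ hy _ hx)) (fun x => S.unstableIn ε' x R) (by
      intro x hx y
      refine ⟨fun h => ⟨h.2, h.1.2⟩, fun h => ⟨⟨?_, h.2⟩, h.1⟩⟩
      have := hdist x hx y h.1
      linarith)
  refine ⟨fun x₀ hx₀ ε hε => ?_, leaf_diam R _ hs, leaf_diam R _ hu⟩
  obtain ⟨δ₁, hδ₁, h₁⟩ := leaf_hd R _ hs ε hε
  obtain ⟨δ₂, hδ₂, h₂⟩ := leaf_hd R _ hu ε hε
  exact ⟨min δ₁ δ₂, lt_min hδ₁ hδ₂, fun x hx hd =>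
    ⟨h₁ x hx x₀ hx₀ (hd.trans_le (min_le_left _ _)),
      h₂ x hx x₀ hx₀ (hd.trans_le (min_le_right _ _))⟩⟩
end
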